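/- Let X be a GC_3 set and let ℓ be a 3-node line of X. Then |X_ℓ| = 1 if and only if there exist two maximal lines M′, M″ of X whose intersection point is a node of X lying on ℓ. In this case X_ℓ = X \ (ℓ ∪ M′ ∪ M″). -/

import Mathlib

open MvPolynomial

/-- Points of the plane `ℝ²`. -/
abbrev Pt : Type := Fin 2 → ℝ

/-- Bivariate real polynomials. -/
abbrev BPoly : Type := MvPolynomial (Fin 2) ℝ

/-- `X` is an `n`-poised node set: it has `N = (n+1)(n+2)/2` nodes and every
interpolation problem with polynomials of total degree at most `n` has a unique solution. -/
def IsPoised (n : ℕ) (X : Set Pt) : Prop :=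
  X.ncard = (n + 1) * (n + 2) / 2 ∧
  ∀ c : Pt → ℝ, ∃! p : BPoly, p.totalDegree ≤ n ∧ ∀ A ∈ X, eval A p = c A

/-- `p` is an `n`-fundamental polynomial of the node `A` for the node set `X`. -/
def IsFund (n : ℕ) (X : Set Pt) (A : Pt) (p : BPoly) : Prop :=
  p.totalDegree ≤ n ∧ eval A p = 1 ∧ ∀ B ∈ X, B ≠ A → eval B p = 0

/-- `X` is a `GC_n` set: it is `n`-poised and each node has a fundamental polynomial
that is a product of `n` polynomials of degree `1`. -/
def IsGC (n : ℕ) (X : Set Pt) : Prop :=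
  IsPoised n X ∧
  ∀ A ∈ X, ∃ p : BPoly, IsFund n X A p ∧
    ∃ f : Fin n → BPoly, (∀ i, (f i).totalDegree = 1) ∧ p = ∏ i, f i

/-- A line is the zero set of a polynomial of degree exactly `1`. -/
def IsLine (L : Set Pt) : Prop :=
  ∃ f : BPoly, f.totalDegree = 1 ∧ L = {x : Pt | eval x f = 0}

/-- A `k`-node line of `X`: a line passing through exactly `k` nodes of `X`. -/
def IsNodeLine (k : ℕ) (X : Set Pt) (L : Set Pt) : Prop :=
  IsLine L ∧ (X ∩ L).ncard = k

/-- A maximal line of an `n`-poised set `X`: an `(n+1)`-node line. -/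
def IsMaxLine (n : ℕ) (X : Set Pt) (L : Set Pt) : Prop :=
  IsNodeLine (n + 1) X L

/-- The node `A` uses the line `L`: a degree-1 polynomial whose zero set is `L`
divides the `n`-fundamental polynomial of `A` with respect to `X`. -/
def Uses (n : ℕ) (X : Set Pt) (L : Set Pt) (A : Pt) : Prop :=
  ∃ p f : BPoly, IsFund n X A p ∧ f.totalDegree = 1 ∧ L = {x : Pt | eval x f = 0} ∧ f ∣ p

/-- `X_ℓ`: the set of nodes of `X` that use the line `L`. -/
def UseSet (n : ℕ) (X : Set Pt) (L : Set Pt) : Set Pt :=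
  {A ∈ X | Uses n X L A}


theorem exists_affine_eval {f : BPoly} (hf : f.totalDegree = 1) :
    ∃ a b c : ℝ, (a ≠ 0 ∨ b ≠ 0) ∧ ∀ x : Pt, eval x f = a * x 0 + b * x 1 + c := by
  classical
  have hne : (0 : Fin 2 →₀ ℕ) ≠ Finsupp.single 0 1 := by
    intro h; simpa using DFunLike.congr_fun h 0
  have hne' : (0 : Fin 2 →₀ ℕ) ≠ Finsupp.single 1 1 := by
    intro h; simpa using DFunLike.congr_fun h 1
  have hne'' : (Finsupp.single 0 1 : Fin 2 →₀ ℕ) ≠ Finsupp.single 1 1 := by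
    intro h; simpa using DFunLike.congr_fun h 0
  have hsub : f.support ⊆ {0, Finsupp.single 0 1, Finsupp.single 1 1} := by
    intro d hd
    have h1 := le_totalDegree hd
    rw [hf, Finsupp.sum_fintype _ _ (fun _ => rfl), Fin.sum_univ_two] at h1
    have : (d 0 = 0 ∧ d 1 = 0) ∨ (d 0 = 1 ∧ d 1 = 0) ∨ (d 0 = 0 ∧ d 1 = 1) := by omega
    simp only [Finset.mem_insert, Finset.mem_singleton]
    rcases this with ⟨h, h'⟩ | ⟨h, h'⟩ | ⟨h, h'⟩
    · left; ext i; fin_cases i <;> simp [h, h']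
    · right; left; ext i; fin_cases i <;> simp [h, h']
    · right; right; ext i; fin_cases i <;> simp [h, h']
  have hev : ∀ x : Pt, eval x f = coeff (Finsupp.single 0 1) f * x 0 +
      coeff (Finsupp.single 1 1) f * x 1 + coeff 0 f := by
    intro x
    rw [eval_eq', Finset.sum_subset hsub]
    · rw [Finset.sum_insert (by simp [hne, hne']), Finset.sum_insert (by simp [hne'']),
        Finset.sum_singleton]
      simp [Fin.prod_univ_two]
      ring
    · intro d _ hd
      simp [notMem_support_iff.mp hd]
  refine ⟨_, _, _, ?_, hev⟩
  by_contra! h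
  have : f = C (coeff 0 f) := by
    apply MvPolynomial.funext
    intro x
    rw [hev, h.1, h.2]
    simp
  rw [this, totalDegree_C] at hf
  exact absurd hf (by norm_num)

/-- Two lines sharing two distinct points coincide. -/
theorem IsLine.eq_of_mem {L L' : Set Pt} (hL : IsLine L) (hL' : IsLine L') {x y : Pt}
    (hxy : x ≠ y) (hx : x ∈ L) (hy : y ∈ L) (hx' : x ∈ L') (hy' : y ∈ L') : L = L' := by
  obtain ⟨f, hf, rfl⟩ := hL
  obtain ⟨g, hg, rfl⟩ := hL'
  obtain ⟨a, b, c, hab, hf⟩ := exists_affine_eval hf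
  obtain ⟨a', b', c', hab', hg⟩ := exists_affine_eval hg
  simp only [Set.mem_ofPred_eq, hf, hg] at *
  have hd : x 0 - y 0 ≠ 0 ∨ x 1 - y 1 ≠ 0 := by
    by_contra! h
    apply hxy
    ext i
    fin_cases i
    · exact sub_eq_zero.mp h.1
    · exact sub_eq_zero.mp h.2
  set u := x 0 - y 0 with hu
  set v := x 1 - y 1 with hv
  have e1 : a * u + b * v = 0 := by rw [hu, hv]; linear_combination hx - hy
  have e2 : a' * u + b' * v = 0 := by rw [hu, hv]; linear_combination hx' - hy'
  have hdet : a * b' = a' * b := by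
    rcases hd with h | h
    · exact mul_left_cancel₀ h (by linear_combination b' * e1 - b * e2)
    · exact mul_left_cancel₀ h (by linear_combination -a' * e1 + a * e2)
  ext z
  simp only [Set.mem_ofPred_eq]
  have key : ∀ {a b c a' b' c' : ℝ}, (a ≠ 0 ∨ b ≠ 0) → a * b' = a' * b →
      a * x 0 + b * x 1 + c = 0 → a' * x 0 + b' * x 1 + c' = 0 →
      a * z 0 + b * z 1 + c = 0 → a' * z 0 + b' * z 1 + c' = 0 := by
    intro a b c a' b' c' hab hdet hx hx' hz
    rcases hab with h | h
    · apply (mul_eq_zero.mp (_ : a * (a' * z 0 + b' * z 1 + c') = 0)).resolve_left h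
      linear_combination a' * hz - a' * hx + a * hx' + (z 1 - x 1) * hdet
    · apply (mul_eq_zero.mp (_ : b * (a' * z 0 + b' * z 1 + c') = 0)).resolve_left h
      linear_combination b' * hz - b' * hx + b * hx' - (z 0 - x 0) * hdet
  exact ⟨key hab hdet hx hx', key hab' hdet.symm hx' hx⟩

theorem IsLine.infinite {L : Set Pt} (hL : IsLine L) {x : Pt} (hx : x ∈ L) : L.Infinite := by
  obtain ⟨f, hf, rfl⟩ := hL
  obtain ⟨a, b, c, hab, hf⟩ := exists_affine_eval hf
  simp only [Set.mem_ofPred_eq, hf] at *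
  refine Set.infinite_of_injective_forall_mem
    (f := fun t : ℝ => (![x 0 - t * b, x 1 + t * a] : Pt)) ?_ ?_
  · intro s t h
    have h0 := congrFun h 0
    have h1 := congrFun h 1
    simp only [Matrix.cons_val_zero, Matrix.cons_val_one, sub_right_inj, add_right_inj] at h0 h1
    rcases hab with h | h
    · exact mul_right_cancel₀ h h1
    · exact mul_right_cancel₀ h h0
  · intro t
    simp only [Set.mem_ofPred_eq, Matrix.cons_val_zero, Matrix.cons_val_one]
    linear_combination hx

/-- The lines `L₁, L₂, L₃` avoid `A` and cover all the other nodes of `X`. -/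
structure Cov (X : Finset Pt) (A : Pt) (L₁ L₂ L₃ : Set Pt) : Prop where
  line₁ : IsLine L₁
  line₂ : IsLine L₂
  line₃ : IsLine L₃
  notMem₁ : A ∉ L₁
  notMem₂ : A ∉ L₂
  notMem₃ : A ∉ L₃
  cover : ∀ B ∈ X, B ≠ A → B ∈ L₁ ∨ B ∈ L₂ ∨ B ∈ L₃

/-- The combinatorial content of the definition of a `GC_3` set. -/
structure IsGCFinset (X : Finset Pt) : Prop where
  card : X.card = 10
  cov : ∀ A ∈ X, ∃ L₁ L₂ L₃, Cov X A L₁ L₂ L₃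

theorem IsGC.isGCFinset {X : Finset Pt} (hX : IsGC 3 X) : IsGCFinset X := by
  refine ⟨by simpa using hX.1.1, fun A hA => ?_⟩
  obtain ⟨p, ⟨-, hp1, hp0⟩, f, hf, rfl⟩ := hX.2 A hA
  simp only [Fin.prod_univ_three, map_mul] at hp1 hp0
  have hne : eval A (f 0) * eval A (f 1) * eval A (f 2) ≠ 0 := by rw [hp1]; exact one_ne_zero
  simp only [mul_ne_zero_iff] at hne
  refine ⟨_, _, _, ⟨f 0, hf 0, rfl⟩, ⟨f 1, hf 1, rfl⟩, ⟨f 2, hf 2, rfl⟩, hne.1.1, hne.1.2, hne.2,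
    fun B hB hBA => ?_⟩
  have := hp0 B hB hBA
  simp only [mul_eq_zero] at this
  simp only [Set.mem_ofPred_eq]
  tauto

theorem uses_of_cov {X : Finset Pt} {A : Pt} {ℓ h k : Set Pt} (hc : Cov X A ℓ h k) :
    Uses 3 X ℓ A := by
  obtain ⟨⟨f, hf, rfl⟩, ⟨g, hg, rfl⟩, ⟨r, hr, rfl⟩, h1, h2, h3, hcov⟩ := hc
  simp only [Set.mem_ofPred_eq] at *
  refine ⟨C (eval A f * eval A g * eval A r)⁻¹ * (f * g * r), f, ⟨?_, ?_, ?_⟩, hf, rfl, ?_⟩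
  · refine (totalDegree_mul _ _).trans ?_
    rw [totalDegree_C, zero_add]
    have e1 := totalDegree_mul (f * g) r
    have e2 := totalDegree_mul f g
    omega
  · simp only [map_mul, eval_C]
    exact inv_mul_cancel₀ (mul_ne_zero (mul_ne_zero h1 h2) h3)
  · intro B hB hBA
    rcases hcov B hB hBA with h | h | h <;> simp [h]
  · exact
      ((dvd_mul_right f g).mul_right r).mul_left _

theorem exists_cov_of_uses {X : Finset Pt} (hX : IsGC 3 X) {A : Pt} (hA : A ∈ X) {ℓ : Set Pt}
    (hne : ℓ.Nonempty) (hu : Uses 3 X ℓ A) : ∃ h k, Cov X A ℓ h k := by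
  classical
  obtain ⟨p, f, hp, hf, rfl, q, rfl⟩ := hu
  obtain ⟨r, hr, g, hg, rfl⟩ := hX.2 A hA
  have heq : f * q = ∏ i, g i := by
    obtain ⟨s, -, hs⟩ := hX.1.2 (fun B => if B = A then 1 else 0)
    have aux : ∀ p, IsFund 3 X A p → p = s := by
      intro p hp
      refine hs p ⟨hp.1, fun B hB => ?_⟩
      by_cases h : B = A
      · subst h; simpa using hp.2.1
      · simpa [h] using hp.2.2 B hB h
    rw [aux _ hp, aux _ hr]
  have hline : IsLine {x : Pt | eval x f = 0} := ⟨f, hf, rfl⟩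
  obtain ⟨x₀, hx₀⟩ := hne
  have hinf := hline.infinite hx₀
  have hsub : {x : Pt | eval x f = 0} ⊆ ⋃ i, ({x : Pt | eval x f = 0} ∩ {x | eval x (g i) = 0}) := by
    intro x hx
    have h0 : eval x (∏ i, g i) = 0 := by
      rw [← heq, map_mul, show eval x f = 0 from hx, zero_mul]
    rw [map_prod, Finset.prod_eq_zero_iff] at h0
    obtain ⟨i, -, hi⟩ := h0
    exact Set.mem_iUnion.mpr ⟨i, hx, hi⟩
  obtain ⟨i, hi⟩ : ∃ i, ({x : Pt | eval x f = 0} ∩ {x | eval x (g i) = 0}).Infinite := by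
    by_contra! h
    exact hinf ((Set.finite_iUnion h).subset hsub)
  obtain ⟨x, hx, y, hy, hxy⟩ := hi.nontrivial
  have hLi : {x : Pt | eval x f = 0} = {x | eval x (g i) = 0} :=
    hline.eq_of_mem ⟨g i, hg i, rfl⟩ hxy hx.1 hy.1 hx.2 hy.2
  obtain ⟨-, hr1, hr0⟩ := hr
  have hgA : ∀ j, eval A (g j) ≠ 0 := by
    intro j hj
    rw [map_prod, Finset.prod_eq_zero (Finset.mem_univ j) hj] at hr1
    exact zero_ne_one hr1
  obtain ⟨j, k, hjk⟩ : ∃ j k : Fin 3, ∀ m, m = i ∨ m = j ∨ m = k := by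
    fin_cases i
    · exact ⟨1, 2, by decide⟩
    · exact ⟨0, 2, by decide⟩
    · exact ⟨0, 1, by decide⟩
  refine ⟨_, _, hline, ⟨g j, hg j, rfl⟩, ⟨g k, hg k, rfl⟩, ?_, hgA j, hgA k, fun B hB hBA => ?_⟩
  · rw [hLi]; exact hgA i
  · have h0 := hr0 B hB hBA
    rw [map_prod, Finset.prod_eq_zero_iff] at h0
    obtain ⟨m, -, hm⟩ := h0
    rw [hLi]
    rcases hjk m with rfl | rfl | rfl
    · exact Or.inl hm
    · exact Or.inr (Or.inl hm)
    · exact Or.inr (Or.inr hm)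

open Classical in
/-- The nodes of `X` on the line `L`. -/
noncomputable def nodesOn (X : Finset Pt) (L : Set Pt) : Finset Pt := X.filter (· ∈ L)

@[simp]
theorem mem_nodesOn {X : Finset Pt} {L : Set Pt} {x : Pt} : x ∈ nodesOn X L ↔ x ∈ X ∧ x ∈ L := by
  simp [nodesOn]

theorem nodesOn_subset (X : Finset Pt) (L : Set Pt) : nodesOn X L ⊆ X :=
  fun _ hx => (mem_nodesOn.mp hx).1

theorem coe_nodesOn (X : Finset Pt) (L : Set Pt) : (nodesOn X L : Set Pt) = ↑X ∩ L := by
  ext x; simp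

theorem isNodeLine_iff {k : ℕ} {X : Finset Pt} {L : Set Pt} :
    IsNodeLine k X L ↔ IsLine L ∧ (nodesOn X L).card = k := by
  rw [IsNodeLine, ← coe_nodesOn, Set.ncard_coe_finset]

theorem Cov.swap₁₂ {X : Finset Pt} {A : Pt} {L₁ L₂ L₃ : Set Pt} (h : Cov X A L₁ L₂ L₃) :
    Cov X A L₂ L₁ L₃ :=
  ⟨h.line₂, h.line₁, h.line₃, h.notMem₂, h.notMem₁, h.notMem₃, fun B hB hBA => by
    have := h.cover B hB hBA; tauto⟩

theorem Cov.swap₂₃ {X : Finset Pt} {A : Pt} {L₁ L₂ L₃ : Set Pt} (h : Cov X A L₁ L₂ L₃) :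
    Cov X A L₁ L₃ L₂ :=
  ⟨h.line₁, h.line₃, h.line₂, h.notMem₁, h.notMem₃, h.notMem₂, fun B hB hBA => by
    have := h.cover B hB hBA; tauto⟩

/-- A set of points of a line `M` which lies on a different line has at most one element. -/
theorem card_le_one_of_line {S : Finset Pt} {M L : Set Pt} (hM : IsLine M) (hL : IsLine L)
    (hne : L ≠ M) (hSM : ∀ x ∈ S, x ∈ M) (hSL : ∀ x ∈ S, x ∈ L) : S.card ≤ 1 := by
  rw [Finset.card_le_one]
  intro x hx y hy
  by_contra hxy
  exact hne (hL.eq_of_mem hM hxy (hSL x hx) (hSL y hy) (hSM x hx) (hSM y hy))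

theorem card_le_two_of_lines {S : Finset Pt} {M L L' : Set Pt} (hM : IsLine M) (hL : IsLine L)
    (hL' : IsLine L') (hne : L ≠ M) (hne' : L' ≠ M) (hSM : ∀ x ∈ S, x ∈ M)
    (hS : ∀ x ∈ S, x ∈ L ∨ x ∈ L') : S.card ≤ 2 := by
  classical
  have h1 : (S.filter (· ∈ L)).card ≤ 1 := card_le_one_of_line hM hL hne
    (fun x hx => hSM x (Finset.mem_filter.mp hx).1) (fun x hx => (Finset.mem_filter.mp hx).2)
  have h2 : (S.filter (· ∉ L)).card ≤ 1 := card_le_one_of_line hM hL' hne'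
    (fun x hx => hSM x (Finset.mem_filter.mp hx).1)
    (fun x hx => (hS x (Finset.mem_filter.mp hx).1).resolve_left (Finset.mem_filter.mp hx).2)
  have := Finset.card_filter_add_card_filter_not (s := S) (· ∈ L)
  omega

theorem card_le_three_of_lines {S : Finset Pt} {M L L' L'' : Set Pt} (hM : IsLine M)
    (hL : IsLine L) (hL' : IsLine L') (hL'' : IsLine L'') (hne : L ≠ M) (hne' : L' ≠ M)
    (hne'' : L'' ≠ M) (hSM : ∀ x ∈ S, x ∈ M)
    (hS : ∀ x ∈ S, x ∈ L ∨ x ∈ L' ∨ x ∈ L'') : S.card ≤ 3 := by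
  classical
  have h1 : (S.filter (· ∈ L)).card ≤ 1 := card_le_one_of_line hM hL hne
    (fun x hx => hSM x (Finset.mem_filter.mp hx).1) (fun x hx => (Finset.mem_filter.mp hx).2)
  have h2 : (S.filter (· ∉ L)).card ≤ 2 := card_le_two_of_lines hM hL' hL'' hne' hne''
    (fun x hx => hSM x (Finset.mem_filter.mp hx).1)
    (fun x hx => (hS x (Finset.mem_filter.mp hx).1).resolve_left (Finset.mem_filter.mp hx).2)
  have := Finset.card_filter_add_card_filter_not (s := S) (· ∈ L)
  omega

section

variable {X : Finset Pt}

theorem Cov.nine_le (hX : IsGCFinset X) {A : Pt} (hA : A ∈ X) {L₁ L₂ L₃ : Set Pt}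
    (h : Cov X A L₁ L₂ L₃) :
    9 ≤ (nodesOn X L₁).card + (nodesOn X L₂).card + (nodesOn X L₃).card := by
  classical
  have hs : X.erase A ⊆ nodesOn X L₁ ∪ nodesOn X L₂ ∪ nodesOn X L₃ := by
    intro x hx
    have := h.cover x (Finset.mem_of_mem_erase hx) (Finset.ne_of_mem_erase hx)
    have := Finset.mem_of_mem_erase hx
    simp only [Finset.mem_union, mem_nodesOn]
    tauto
  have h1 := Finset.card_le_card hs
  rw [Finset.card_erase_of_mem hA, hX.card] at h1
  have h2 := Finset.card_union_le (nodesOn X L₁ ∪ nodesOn X L₂) (nodesOn X L₃)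
  have h3 := Finset.card_union_le (nodesOn X L₁) (nodesOn X L₂)
  omega

theorem IsGCFinset.card_le_four (hX : IsGCFinset X) {L : Set Pt} (hL : IsLine L) :
    (nodesOn X L).card ≤ 4 := by
  classical
  by_contra! hlt
  obtain ⟨A, hA⟩ := Finset.card_pos.mp (by omega : 0 < (nodesOn X L).card)
  rw [mem_nodesOn] at hA
  obtain ⟨L₁, L₂, L₃, h⟩ := hX.cov A hA.1
  have h3 : ((nodesOn X L).erase A).card ≤ 3 := by
    refine card_le_three_of_lines hL h.line₁ h.line₂ h.line₃ ?_ ?_ ?_ ?_ ?_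
    · rintro rfl; exact h.notMem₁ hA.2
    · rintro rfl; exact h.notMem₂ hA.2
    · rintro rfl; exact h.notMem₃ hA.2
    · intro x hx; simp at hx; exact hx.2.2
    · intro x hx; simp at hx; exact h.cover x hx.2.1 hx.1
  rw [Finset.card_erase_of_mem (by simpa using hA)] at h3
  omega

/-- A maximal line is used by every node outside it. -/
theorem Cov.eq_or_of_max {A : Pt} {L₁ L₂ L₃ M : Set Pt} (h : Cov X A L₁ L₂ L₃) (hM : IsLine M)
    (hM4 : (nodesOn X M).card = 4) (hAM : A ∉ M) : L₁ = M ∨ L₂ = M ∨ L₃ = M := by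
  by_contra! hne
  have h3 : (nodesOn X M).card ≤ 3 := by
    refine card_le_three_of_lines hM h.line₁ h.line₂ h.line₃ hne.1 hne.2.1 hne.2.2 ?_ ?_
    · intro x hx; simp at hx; exact hx.2
    · intro x hx; simp at hx; exact h.cover x hx.1 (by rintro rfl; exact hAM hx.2)
  omega

theorem IsGCFinset.exists_cov_max (hX : IsGCFinset X) {A : Pt} (hA : A ∈ X) {M : Set Pt}
    (hM : IsLine M) (hM4 : (nodesOn X M).card = 4) (hAM : A ∉ M) : ∃ h k, Cov X A M h k := by
  obtain ⟨L₁, L₂, L₃, h⟩ := hX.cov A hA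
  rcases h.eq_or_of_max hM hM4 hAM with rfl | rfl | rfl
  · exact ⟨_, _, h⟩
  · exact ⟨_, _, h.swap₁₂⟩
  · exact ⟨_, _, h.swap₂₃.swap₁₂⟩

theorem Cov.exists_cov_max {A : Pt} {L h k M : Set Pt} (hc : Cov X A L h k) (hM : IsLine M)
    (hM4 : (nodesOn X M).card = 4) (hAM : A ∉ M) (hne : L ≠ M) : ∃ k, Cov X A L M k := by
  rcases hc.eq_or_of_max hM hM4 hAM with rfl | rfl | rfl
  · exact absurd rfl hne
  · exact ⟨_, hc⟩
  · exact ⟨_, hc.swap₂₃⟩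

/-- Two maximal lines meet at a node. -/
theorem IsGCFinset.exists_mem_of_max (hX : IsGCFinset X) {M M' : Set Pt} (hM : IsLine M)
    (hM4 : (nodesOn X M).card = 4) (hM' : IsLine M') (hM4' : (nodesOn X M').card = 4)
    (hne : M ≠ M') : ∃ D ∈ X, D ∈ M ∧ D ∈ M' := by
  classical
  by_contra! hdis
  obtain ⟨A, hA⟩ := Finset.card_pos.mp (by omega : 0 < (nodesOn X M).card)
  have hA' := mem_nodesOn.mp hA
  obtain ⟨h, k, hc⟩ := hX.exists_cov_max hA'.1 hM' hM4' (hdis A hA'.1 hA'.2)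
  have h2 : ((nodesOn X M).erase A).card ≤ 2 := by
    refine card_le_two_of_lines hM hc.line₂ hc.line₃ ?_ ?_ ?_ ?_
    · rintro rfl; exact hc.notMem₂ hA'.2
    · rintro rfl; exact hc.notMem₃ hA'.2
    · intro x hx; simp at hx; exact hx.2.2
    · intro x hx
      simp at hx
      exact (hc.cover x hx.2.1 hx.1).resolve_left (hdis x hx.2.1 hx.2.2)
  rw [Finset.card_erase_of_mem hA] at h2
  omega

/-- If the maximal line `M` and the line `L` with three nodes do not meet at a node, then `L` is
used by the nodes outside `M ∪ L`. -/
theorem IsGCFinset.exists_cov_of_disjoint (hX : IsGCFinset X) {M L : Set Pt} (hM : IsLine M)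
    (hM4 : (nodesOn X M).card = 4) (hL : IsLine L) (hL3 : (nodesOn X L).card = 3)
    (hdis : ∀ x ∈ X, x ∈ M → x ∉ L) {B : Pt} (hB : B ∈ X) (hBM : B ∉ M) (hBL : B ∉ L) :
    ∃ h k, Cov X B L h k := by
  obtain ⟨h, k, hc⟩ := hX.exists_cov_max hB hM hM4 hBM
  have : h = L ∨ k = L := by
    by_contra! hne
    have h2 : (nodesOn X L).card ≤ 2 := by
      refine card_le_two_of_lines hL hc.line₂ hc.line₃ hne.1 hne.2 ?_ ?_
      · intro x hx; simp at hx; exact hx.2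
      · intro x hx
        simp at hx
        exact (hc.cover x hx.1 (by rintro rfl; exact hBL hx.2)).resolve_left
          (fun hxM => hdis x hx.1 hxM hx.2)
    omega
  rcases this with rfl | rfl
  · exact ⟨_, _, hc.swap₁₂⟩
  · exact ⟨_, _, hc.swap₂₃.swap₁₂⟩

/-- A line with three nodes that is used by two nodes is disjoint from some maximal line. -/
theorem IsGCFinset.exists_max_of_two_users (hX : IsGCFinset X) {L : Set Pt}
    (hL3 : (nodesOn X L).card = 3) {B B' : Pt} (hB : B ∈ X) (hB' : B' ∈ X) (hne : B ≠ B')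
    {h k h' k' : Set Pt} (hc : Cov X B L h k) (hc' : Cov X B' L h' k') :
    ∃ M, IsLine M ∧ (nodesOn X M).card = 4 ∧ ∀ x ∈ X, x ∈ M → x ∉ L := by
  classical
  by_contra! hno
  set Y := X \ nodesOn X L with hY
  have hYc : Y.card = 7 := by
    rw [hY, Finset.card_sdiff_of_subset (nodesOn_subset X L), hX.card, hL3]
  have hmemY : ∀ {x}, x ∈ Y ↔ x ∈ X ∧ x ∉ L := by
    intro x; simp only [hY, Finset.mem_sdiff, mem_nodesOn]; tauto
  have hle : ∀ K, IsLine K → (nodesOn Y K).card ≤ 3 := by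
    intro K hK
    by_contra! h4
    have hsub : nodesOn Y K ⊆ nodesOn X K := by
      intro x; simp only [mem_nodesOn, hmemY]; tauto
    have hc4 := Finset.card_le_card hsub
    have := hX.card_le_four hK
    obtain ⟨x, hxX, hxK, hxL⟩ := hno K hK (by omega)
    have heq := Finset.eq_of_subset_of_card_le hsub (by omega)
    have : x ∈ nodesOn Y K := by rw [heq]; simp [hxX, hxK]
    rw [mem_nodesOn, hmemY] at this
    exact this.1.2 hxL
  have hBY : B ∈ Y := hmemY.mpr ⟨hB, hc.notMem₁⟩
  have hBY' : B' ∈ Y := hmemY.mpr ⟨hB', hc'.notMem₁⟩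
  have hcov : Y.erase B ⊆ nodesOn Y h ∪ nodesOn Y k := by
    intro x hx
    have hx1 := Finset.mem_of_mem_erase hx
    have := (hc.cover x (hmemY.mp hx1).1 (Finset.ne_of_mem_erase hx)).resolve_left (hmemY.mp hx1).2
    simp only [Finset.mem_union, mem_nodesOn]
    tauto
  have hcard := Finset.card_le_card hcov
  have hi := Finset.card_union_add_card_inter (nodesOn Y h) (nodesOn Y k)
  rw [Finset.card_erase_of_mem hBY, hYc] at hcard
  have h3 := hle h hc.line₂
  have k3 := hle k hc.line₃
  have hdis : ∀ x, x ∈ Y → x ∈ h → x ∉ k := by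
    intro x hx hxh hxk
    have : 0 < (nodesOn Y h ∩ nodesOn Y k).card :=
      Finset.card_pos.mpr ⟨x, by simp [hx, hxh, hxk]⟩
    omega
  have hB'c := (hc.cover B' hB' hne.symm).resolve_left hc'.notMem₁
  have key : ∀ h k h' k', IsLine h → IsLine k → IsLine h' → IsLine k' → (nodesOn Y h).card = 3 →
      (nodesOn Y k).card = 3 → (∀ x, x ∈ Y → x ∈ h → x ∉ k) → B' ∈ h → B' ∉ h' → k' = k →
      (∀ x ∈ Y, x ≠ B' → x ∈ h' ∨ x ∈ k') → False := by
    rintro h k h' _ hh hk hh' hk' h3 k3 hdis hB'h hB'h' rfl hcov'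
    have h1 : ((nodesOn Y h).erase B').card ≤ 1 := by
      refine card_le_one_of_line hh hh' (by rintro rfl; exact hB'h' hB'h) ?_ ?_
      · intro x hx; simp at hx; exact hx.2.2
      · intro x hx
        simp at hx
        exact (hcov' x hx.2.1 hx.1).resolve_right (hdis x hx.2.1 hx.2.2)
    rw [Finset.card_erase_of_mem (by simp [hB'h, hBY'])] at h1
    omega
  have key2 : ∀ h k, IsLine h → IsLine k → (nodesOn Y h).card = 3 →
      (nodesOn Y k).card = 3 → (∀ x, x ∈ Y → x ∈ h → x ∉ k) → B' ∈ h → False := by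
    intro h k hh hk h3 k3 hdis hB'h
    have hcov' : ∀ x ∈ Y, x ≠ B' → x ∈ h' ∨ x ∈ k' := fun x hx hxB =>
      (hc'.cover x (hmemY.mp hx).1 hxB).resolve_left (hmemY.mp hx).2
    have : h' = k ∨ k' = k := by
      by_contra! hne
      have h2 : (nodesOn Y k).card ≤ 2 := by
        refine card_le_two_of_lines hk hc'.line₂ hc'.line₃ hne.1 hne.2 ?_ ?_
        · intro x hx; simp at hx; exact hx.2
        · intro x hx
          simp at hx
          exact hcov' x hx.1 (by rintro rfl; exact hdis _ hx.1 hB'h hx.2)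
      omega
    rcases this with e | e
    · exact key h k k' h' hh hk hc'.line₃ hc'.line₂ h3 k3 hdis hB'h hc'.notMem₃ e
        (fun x hx hxB => (hcov' x hx hxB).symm)
    · exact key h k h' k' hh hk hc'.line₂ hc'.line₃ h3 k3 hdis hB'h hc'.notMem₂ e hcov'
  rcases hB'c with hh | hk
  · exact key2 h k hc.line₂ hc.line₃ (by omega) (by omega) hdis hh
  · exact key2 k h hc.line₃ hc.line₂ (by omega) (by omega)
      (fun x hx hxk hxh => hdis x hx hxh hxk) hk

/-- If no line has four nodes, the nodes using a line are on disjoint lines with three nodes. -/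
theorem Cov.card_eq_three (hX : IsGCFinset X) {A : Pt} (hA : A ∈ X) {L₁ L₂ L₃ : Set Pt}
    (h : Cov X A L₁ L₂ L₃) (h1 : (nodesOn X L₁).card ≠ 4) (h2 : (nodesOn X L₂).card ≠ 4)
    (h3 : (nodesOn X L₃).card ≠ 4) : (nodesOn X L₁).card = 3 := by
  have := h.nine_le hX hA
  have := hX.card_le_four h.line₁
  have := hX.card_le_four h.line₂
  have := hX.card_le_four h.line₃
  omega

/-- Each node `B ≠ R` uses a line through `R`. -/
theorem IsGCFinset.exists_cov_mem (hX : IsGCFinset X) {B R : Pt} (hB : B ∈ X) (hR : R ∈ X)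
    (hne : R ≠ B) : ∃ g h k, Cov X B g h k ∧ R ∈ g := by
  obtain ⟨L₁, L₂, L₃, h⟩ := hX.cov B hB
  rcases h.cover R hR hne with hR | hR | hR
  · exact ⟨_, _, _, h, hR⟩
  · exact ⟨_, _, _, h.swap₁₂, hR⟩
  · exact ⟨_, _, _, h.swap₂₃.swap₁₂, hR⟩

/-- The Gasca–Maeztu property for `n = 3`. -/
theorem IsGCFinset.exists_max (hX : IsGCFinset X) :
    ∃ M, IsLine M ∧ (nodesOn X M).card = 4 := by
  classical
  by_contra! hno
  obtain ⟨R, hR⟩ := Finset.card_pos.mp (by rw [hX.card]; norm_num : 0 < X.card)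
  have hg : ∀ B : Pt, ∃ g, B ∈ X.erase R → IsLine g ∧ R ∈ g ∧ (nodesOn X g).card = 3 ∧
      ∃ h k, Cov X B g h k := by
    intro B
    by_cases hB : B ∈ X.erase R
    · have hBX := Finset.mem_of_mem_erase hB
      obtain ⟨g, h, k, hc, hRg⟩ := hX.exists_cov_mem hBX hR (Finset.ne_of_mem_erase hB).symm
      exact ⟨g, fun _ => ⟨hc.line₁, hRg, hc.card_eq_three hX hBX (hno _ hc.line₁)
        (hno _ hc.line₂) (hno _ hc.line₃), h, k, hc⟩⟩
    · exact ⟨∅, fun h => absurd h hB⟩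
  choose g hg using hg
  have hdis : ((X.erase R : Finset Pt) : Set Pt).PairwiseDisjoint
      (fun B => (nodesOn X (g B)).erase R) := by
    intro B hB B' hB' hne
    obtain ⟨hl, hRg, h3, h, k, hc⟩ := hg B hB
    obtain ⟨hl', hRg', h3', h', k', hc'⟩ := hg B' hB'
    rw [Function.onFun, Finset.disjoint_left]
    intro x hx hx'
    simp only [Finset.mem_erase, mem_nodesOn] at hx hx'
    have heq := hl.eq_of_mem hl' hx.1 hx.2.2 hRg hx'.2.2 hRg'
    rw [← heq] at hc'
    obtain ⟨M, hM, hM4, -⟩ := hX.exists_max_of_two_users h3 (Finset.mem_of_mem_erase hB)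
      (Finset.mem_of_mem_erase hB') hne hc hc'
    exact hno M hM hM4
  have hsub : (X.erase R).biUnion (fun B => (nodesOn X (g B)).erase R) ⊆ X.erase R := by
    intro x hx
    obtain ⟨B, -, hx⟩ := Finset.mem_biUnion.mp hx
    exact Finset.erase_subset_erase _ (nodesOn_subset _ _) hx
  have hle := Finset.card_le_card hsub
  rw [Finset.card_biUnion (fun B hB B' hB' hne => hdis hB hB' hne),
    Finset.sum_congr rfl (g := fun _ => 2), Finset.sum_const, Finset.card_erase_of_mem hR,
    hX.card] at hle
  · norm_num at hle
  · intro B hB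
    obtain ⟨-, hRg, h3, -⟩ := hg B hB
    rw [Finset.card_erase_of_mem (by simp [hR, hRg]), h3]

end

section

variable {X : Finset Pt}

/-- The line `ℓ` has three nodes, is used by `A` only, and no two maximal lines meet at a node
on `ℓ`. -/
structure SoleUser (X : Finset Pt) (ℓ : Set Pt) (A : Pt) : Prop where
  gc : IsGCFinset X
  line : IsLine ℓ
  card : (nodesOn X ℓ).card = 3
  mem : A ∈ X
  cov : ∃ h k, Cov X A ℓ h k
  eq_of_cov : ∀ B ∈ X, ∀ h k, Cov X B ℓ h k → B = A
  eq_of_mem : ∀ M M', IsLine M → (nodesOn X M).card = 4 → IsLine M' → (nodesOn X M').card = 4 →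
    ∀ x ∈ X, x ∈ ℓ → x ∈ M → x ∈ M' → M = M'

theorem SoleUser.ne_of_max {ℓ : Set Pt} {A : Pt} (hs : SoleUser X ℓ A) {M : Set Pt}
    (hM4 : (nodesOn X M).card = 4) : ℓ ≠ M := by
  rintro rfl
  have := hs.card
  omega

theorem SoleUser.exists_mem_of_max {ℓ : Set Pt} {A : Pt} (hs : SoleUser X ℓ A) {M : Set Pt}
    (hM : IsLine M) (hM4 : (nodesOn X M).card = 4) : ∃ P ∈ X, P ∈ M ∧ P ∈ ℓ := by
  classical
  by_contra! hdis
  have hc : 1 < (X \ (nodesOn X M ∪ nodesOn X ℓ)).card := by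
    have h1 := Finset.le_card_sdiff (nodesOn X M ∪ nodesOn X ℓ) X
    have h2 := Finset.card_union_le (nodesOn X M) (nodesOn X ℓ)
    have := hs.card
    have := hs.gc.card
    omega
  obtain ⟨B, hB, B', hB', hne⟩ := Finset.one_lt_card.mp hc
  have key : ∀ B ∈ X \ (nodesOn X M ∪ nodesOn X ℓ), B = A := by
    intro B hB
    simp only [Finset.mem_sdiff, Finset.mem_union, mem_nodesOn, not_or, not_and] at hB
    obtain ⟨h, k, hc⟩ := hs.gc.exists_cov_of_disjoint hM hM4 hs.line hs.card hdis hB.1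
      (hB.2.1 hB.1) (hB.2.2 hB.1)
    exact hs.eq_of_cov B hB.1 h k hc
  exact hne ((key B hB).trans (key B' hB').symm)

/-- The only user of `ℓ` lies on one of any two maximal lines. -/
theorem SoleUser.mem_or_mem {ℓ : Set Pt} {A : Pt} (hs : SoleUser X ℓ A) {M M' : Set Pt}
    (hM : IsLine M) (hM4 : (nodesOn X M).card = 4) (hM' : IsLine M')
    (hM4' : (nodesOn X M').card = 4) (hne : M ≠ M') : A ∈ M ∨ A ∈ M' := by
  classical
  by_contra! hA
  obtain ⟨h, k, hc⟩ := hs.cov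
  obtain ⟨k, hc⟩ := hc.exists_cov_max hM hM4 hA.1 (hs.ne_of_max hM4)
  have hk : k = M' :=
    ((hc.eq_or_of_max hM' hM4' hA.2).resolve_left (hs.ne_of_max hM4')).resolve_left hne
  subst hk
  obtain ⟨P, hPX, hPM, hPl⟩ := hs.exists_mem_of_max hM hM4
  obtain ⟨Q, hQX, hQM, hQl⟩ := hs.exists_mem_of_max hM' hM4'
  have hPQ : P ≠ Q := by
    rintro rfl
    exact hne (hs.eq_of_mem _ _ hM hM4 hM' hM4' P hPX hPl hPM hQM)
  obtain ⟨D, hDX, hDM, hDM'⟩ := hs.gc.exists_mem_of_max hM hM4 hM' hM4' hne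
  have hsub : X.erase A ⊆ ((nodesOn X ℓ).erase P).erase Q ∪ (nodesOn X M ∪ nodesOn X k) := by
    intro x hx
    have hxX := Finset.mem_of_mem_erase hx
    have := hc.cover x hxX (Finset.ne_of_mem_erase hx)
    simp only [Finset.mem_union, Finset.mem_erase, mem_nodesOn]
    grind
  have h1 := Finset.card_le_card hsub
  rw [Finset.card_erase_of_mem hs.mem, hs.gc.card] at h1
  have h2 := Finset.card_union_le (((nodesOn X ℓ).erase P).erase Q) (nodesOn X M ∪ nodesOn X k)
  rw [Finset.card_erase_of_mem (by simp [hPQ.symm, hQX, hQl]),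
    Finset.card_erase_of_mem (by simp [hPX, hPl]), hs.card] at h2
  have h3 := Finset.card_union_add_card_inter (nodesOn X M) (nodesOn X k)
  have h4 : 0 < (nodesOn X M ∩ nodesOn X k).card :=
    Finset.card_pos.mpr ⟨D, by simp [hDX, hDM, hDM']⟩
  omega

theorem exists_pair_of_card_three {L : Set Pt} (h : (nodesOn X L).card = 3) {P : Pt}
    (hP : P ∈ X) (hPL : P ∈ L) : ∃ Q R, Q ∈ X ∧ R ∈ X ∧ Q ∈ L ∧ R ∈ L ∧ P ≠ Q ∧ P ≠ R ∧ Q ≠ R ∧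
      ∀ x ∈ X, x ∈ L → x = P ∨ x = Q ∨ x = R := by
  classical
  have : ((nodesOn X L).erase P).card = 2 := by
    rw [Finset.card_erase_of_mem (by simp [hP, hPL]), h]
  obtain ⟨Q, R, hne, heq⟩ := Finset.card_eq_two.mp this
  have hm : ∀ x, x ∈ (nodesOn X L).erase P ↔ x = Q ∨ x = R := by intro x; rw [heq]; simp
  simp only [Finset.mem_erase, mem_nodesOn] at hm
  exact ⟨Q, R, by grind⟩

theorem exists_pair_of_card_four {L : Set Pt} (h : (nodesOn X L).card = 4) {P Q : Pt}
    (hP : P ∈ X) (hPL : P ∈ L) (hQ : Q ∈ X) (hQL : Q ∈ L) (hPQ : P ≠ Q) :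
    ∃ a b, a ∈ X ∧ b ∈ X ∧ a ∈ L ∧ b ∈ L ∧ P ≠ a ∧ P ≠ b ∧ Q ≠ a ∧ Q ≠ b ∧ a ≠ b ∧
      ∀ x ∈ X, x ∈ L → x = P ∨ x = Q ∨ x = a ∨ x = b := by
  classical
  have : (((nodesOn X L).erase P).erase Q).card = 2 := by
    rw [Finset.card_erase_of_mem (by simp [hQ, hQL, hPQ.symm]),
      Finset.card_erase_of_mem (by simp [hP, hPL]), h]
  obtain ⟨a, b, hne, heq⟩ := Finset.card_eq_two.mp this
  have hm : ∀ x, x ∈ ((nodesOn X L).erase P).erase Q ↔ x = a ∨ x = b := by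
    intro x; rw [heq]; simp
  simp only [Finset.mem_erase, mem_nodesOn] at hm
  exact ⟨a, b, by grind⟩

/-- The two lines used by `a`, besides a maximal line, separate the other nodes of a line
through `a`. -/
theorem IsGCFinset.exists_cov_separating (hX : IsGCFinset X) {M M' : Set Pt} (hM : IsLine M)
    (hM' : IsLine M') (hM4' : (nodesOn X M').card = 4) {a x y : Pt} (ha : a ∈ X) (hx : x ∈ X)
    (hy : y ∈ X) (haM : a ∈ M) (hxM : x ∈ M) (hyM : y ∈ M) (haM' : a ∉ M') (hxM' : x ∉ M')
    (hyM' : y ∉ M') (hax : a ≠ x) (hay : a ≠ y) (hxy : x ≠ y) :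
    ∃ h k, Cov X a M' h k ∧ x ∈ h ∧ y ∈ k ∧ x ∉ k ∧ y ∉ h := by
  obtain ⟨h, k, hc⟩ := hX.exists_cov_max ha hM' hM4' haM'
  have hx1 := (hc.cover x hx hax.symm).resolve_left hxM'
  have hy1 := (hc.cover y hy hay.symm).resolve_left hyM'
  have hh : ¬ (x ∈ h ∧ y ∈ h) := fun hxy' => hc.notMem₂ <| by
    rwa [hc.line₂.eq_of_mem hM hxy hxy'.1 hxy'.2 hxM hyM]
  have hk : ¬ (x ∈ k ∧ y ∈ k) := fun hxy' => hc.notMem₃ <| by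
    rwa [hc.line₃.eq_of_mem hM hxy hxy'.1 hxy'.2 hxM hyM]
  by_cases hxh : x ∈ h
  · exact ⟨h, k, hc, hxh, by tauto, by tauto, by tauto⟩
  · exact ⟨k, h, hc.swap₂₃, by tauto, by tauto, by tauto, by tauto⟩

/-- Three maximal lines are not concurrent at a node. -/
theorem IsGCFinset.not_concurrent (hX : IsGCFinset X) {M₁ M₂ M₃ : Set Pt} (h₁ : IsLine M₁)
    (h₁4 : (nodesOn X M₁).card = 4) (h₂ : IsLine M₂) (h₂4 : (nodesOn X M₂).card = 4)
    (h₃ : IsLine M₃) (h₃4 : (nodesOn X M₃).card = 4) (h₁₂ : M₁ ≠ M₂) (h₁₃ : M₁ ≠ M₃)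
    (h₂₃ : M₂ ≠ M₃) {D : Pt} (hD : D ∈ X) (hD₁ : D ∈ M₁) (hD₂ : D ∈ M₂) : D ∉ M₃ := by
  intro hD₃
  obtain ⟨Q, hQ⟩ := Finset.exists_mem_ne (by omega : 1 < (nodesOn X M₁).card) D
  rw [mem_nodesOn] at hQ
  obtain ⟨a, b, ha, hb, ha₁, hb₁, hDa, hDb, hQa, hQb, hab, -⟩ :=
    exists_pair_of_card_four h₁4 hD hD₁ hQ.1.1 hQ.1.2 hQ.2.symm
  have hn₂ : ∀ x, D ≠ x → x ∈ M₁ → x ∉ M₂ := fun x hx hx₁ hx₂ =>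
    h₁₂ (h₁.eq_of_mem h₂ hx hD₁ hx₁ hD₂ hx₂)
  have hn₃ : ∀ x, D ≠ x → x ∈ M₁ → x ∉ M₃ := fun x hx hx₁ hx₃ =>
    h₁₃ (h₁.eq_of_mem h₃ hx hD₁ hx₁ hD₃ hx₃)
  obtain ⟨h, k, hc⟩ := hX.exists_cov_max hQ.1.1 h₂ h₂4 (hn₂ Q hQ.2.symm hQ.1.2)
  obtain ⟨k, hc⟩ := hc.exists_cov_max h₃ h₃4 (hn₃ Q hQ.2.symm hQ.1.2) h₂₃
  have ha' := hc.cover a ha hQa.symm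
  have hb' := hc.cover b hb hQb.symm
  have hak : a ∈ k := (ha'.resolve_left (hn₂ a hDa ha₁)).resolve_left (hn₃ a hDa ha₁)
  have hbk : b ∈ k := (hb'.resolve_left (hn₂ b hDb hb₁)).resolve_left (hn₃ b hDb hb₁)
  apply hc.notMem₃
  rw [hc.line₃.eq_of_mem h₁ hab hak hbk ha₁ hb₁]
  exact hQ.1.2

theorem four_le_card_nodesOn {L : Set Pt} {w x y z : Pt} (hn : [w, x, y, z].Nodup)
    (hX : ∀ v ∈ [w, x, y, z], v ∈ X) (hL : ∀ v ∈ [w, x, y, z], v ∈ L) :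
    4 ≤ (nodesOn X L).card := by
  classical
  rw [show 4 = ([w, x, y, z].toFinset).card by rw [List.toFinset_card_of_nodup hn]; rfl]
  apply Finset.card_le_card
  intro v hv
  rw [List.mem_toFinset] at hv
  exact mem_nodesOn.mpr ⟨hX v hv, hL v hv⟩

theorem SoleUser.false_of_unique_max {ℓ : Set Pt} {A : Pt} (hs : SoleUser X ℓ A) {M : Set Pt}
    (hM : IsLine M) (hM4 : (nodesOn X M).card = 4)
    (only : ∀ L, IsLine L → (nodesOn X L).card = 4 → L = M) : False := by
  classical
  have hX := hs.gc
  obtain ⟨P, hPX, hPM, hPl⟩ := hs.exists_mem_of_max hM hM4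
  obtain ⟨Q, R, hQX, hRX, hQl, hRl, hPQ, hPR, hQR, hl⟩ := exists_pair_of_card_three hs.card hPX hPl
  have hoff : ∀ x ∈ X, x ∈ ℓ → P ≠ x → x ∉ M := fun x hx hxl hne hxM =>
    hs.ne_of_max hM4 (hs.line.eq_of_mem hM hne hPl hxl hPM hxM)
  have hRM := hoff R hRX hRl hPR
  have hQM := hoff Q hQX hQl hPQ
  have hg : ∀ B : Pt, ∃ g m, B ∈ (nodesOn X M).erase A → IsLine g ∧ R ∈ g ∧
      (nodesOn X g).card = 3 ∧ m ∈ (nodesOn X M).erase P ∧ m ∈ g ∧ ∃ h k, Cov X B g h k := by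
    intro B
    by_cases hB : B ∈ (nodesOn X M).erase A
    swap
    · exact ⟨∅, 0, fun h => absurd h hB⟩
    simp only [Finset.mem_erase, mem_nodesOn] at hB
    obtain ⟨g, h, k, hc, hRg⟩ := hX.exists_cov_mem hB.2.1 hRX
      (by rintro rfl; exact hRM hB.2.2)
    have hgM : g ≠ M := by rintro rfl; exact hRM hRg
    have hhM : h ≠ M := by rintro rfl; exact hc.notMem₂ hB.2.2
    have hkM : k ≠ M := by rintro rfl; exact hc.notMem₃ hB.2.2
    have hg3 := hc.card_eq_three hX hB.2.1 (fun e => hgM (only g hc.line₁ e))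
      (fun e => hhM (only h hc.line₂ e)) (fun e => hkM (only k hc.line₃ e))
    obtain ⟨m, hmX, hmM, hmg⟩ : ∃ m ∈ X, m ∈ M ∧ m ∈ g := by
      by_contra! hdis
      have h2 : ((nodesOn X M).erase B).card ≤ 2 := by
        refine card_le_two_of_lines hM hc.line₂ hc.line₃ hhM hkM ?_ ?_
        · intro x hx; simp at hx; exact hx.2.2
        · intro x hx
          simp at hx
          exact (hc.cover x hx.2.1 hx.1).resolve_left (hdis x hx.2.1 hx.2.2)
      rw [Finset.card_erase_of_mem (by simp [hB.2]), hM4] at h2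
      omega
    refine ⟨g, m, fun _ => ⟨hc.line₁, hRg, hg3, ?_, hmg, h, k, hc⟩⟩
    simp only [Finset.mem_erase, mem_nodesOn]
    refine ⟨?_, hmX, hmM⟩
    rintro rfl
    have : g = ℓ := hc.line₁.eq_of_mem hs.line hPR hmg hRg hPl hRl
    rw [this] at hc
    exact hB.1 (hs.eq_of_cov B hB.2.1 h k hc)
  choose g m hg using hg
  have huniq : ∀ B ∈ (nodesOn X M).erase A, ∀ B' ∈ X, ∀ g' h k, IsLine g' → R ∈ g' →
      m B ∈ g' → Cov X B' g' h k → B = B' := by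
    intro B hB B' hB' g' h' k' hg' hRg' hmg' hc'
    obtain ⟨hgl, hRg, hg3, hm, hmg, h, k, hc⟩ := hg B hB
    simp only [Finset.mem_erase, mem_nodesOn] at hm hB
    have heq : g B = g' := hgl.eq_of_mem hg' (by rintro rfl; exact hRM hm.2.2) hRg hmg hRg' hmg'
    rw [← heq] at hc'
    by_contra hne
    obtain ⟨K, hK, hK4, hdis⟩ := hX.exists_max_of_two_users hg3 hB.2.1 hB' hne hc hc'
    rw [only K hK hK4] at hdis
    exact hdis _ hm.2.1 hm.2.2 hmg
  have hinj : Set.InjOn m ((nodesOn X M).erase A : Finset Pt) := by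
    intro B hB B' hB' heq
    obtain ⟨hgl', hRg', -, -, hmg', h', k', hc'⟩ := hg B' hB'
    exact huniq B hB B' (mem_nodesOn.mp (Finset.mem_of_mem_erase hB')).1 _ _ _ hgl' hRg'
      (heq ▸ hmg') hc'
  have hsub : ((nodesOn X M).erase A).image m ⊆ (nodesOn X M).erase P := by
    intro x hx
    obtain ⟨B, hB, rfl⟩ := Finset.mem_image.mp hx
    exact (hg B hB).2.2.2.1
  have hTc : ((nodesOn X M).erase P).card = 3 := by
    rw [Finset.card_erase_of_mem (by simp [hPX, hPM]), hM4]
  have hSc := Finset.card_image_of_injOn hinj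
  have hle := Finset.card_le_card hsub
  have hAM : A ∈ M := by
    by_contra hAM
    rw [Finset.erase_eq_of_notMem (by simp [hAM])] at hSc hle
    omega
  have himg : ((nodesOn X M).erase A).image m = (nodesOn X M).erase P := by
    apply Finset.eq_of_subset_of_card_le hsub
    rw [hSc, hTc, Finset.card_erase_of_mem (by simp [hAM, hs.mem]), hM4]
  have hdisM : ∀ B ∈ X, B ∉ M → ∀ g' h k, R ∈ g' → Cov X B g' h k → ∀ x ∈ X, x ∈ M → x ∉ g' := by
    intro B hB hBM g' h k hRg' hc x hx hxM hxg'
    by_cases hxP : x = P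
    · subst hxP
      have : g' = ℓ := hc.line₁.eq_of_mem hs.line hPR hxg' hRg' hPl hRl
      rw [this] at hc
      exact hBM (hs.eq_of_cov B hB h k hc ▸ hAM)
    · have hxT : x ∈ (nodesOn X M).erase P := by simp [hxP, hx, hxM]
      rw [← himg] at hxT
      obtain ⟨B', hB', rfl⟩ := Finset.mem_image.mp hxT
      have := huniq B' hB' B hB g' h k hc.line₁ hRg' hxg' hc
      subst this
      exact hBM (mem_nodesOn.mp (Finset.mem_of_mem_erase hB')).2
  have hgm : ∀ x ∈ (nodesOn X M).erase P, ∃ g, IsLine g ∧ R ∈ g ∧ x ∈ g ∧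
      (nodesOn X g).card = 3 := by
    intro x hx
    rw [← himg] at hx
    obtain ⟨B, hB, rfl⟩ := Finset.mem_image.mp hx
    obtain ⟨hgl, hRg, hg3, hm, hmg, -⟩ := hg B hB
    exact ⟨_, hgl, hRg, hmg, hg3⟩
  obtain ⟨m₁, m₂, m₃, h12, h13, h23, hT⟩ := Finset.card_eq_three.mp hTc
  have hmem : ∀ x, (x ≠ P ∧ x ∈ X ∧ x ∈ M) ↔ x = m₁ ∨ x = m₂ ∨ x = m₃ := by
    intro x
    rw [← mem_nodesOn, ← Finset.mem_erase, hT]; simp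
  have hm₁ := (hmem m₁).mpr (by simp)
  have hm₂ := (hmem m₂).mpr (by simp)
  have hm₃ := (hmem m₃).mpr (by simp)
  obtain ⟨g₁, hl₁, hR₁, hmg₁, hc₁⟩ := hgm m₁ (by simp [hm₁])
  obtain ⟨g₂, hl₂, hR₂, hmg₂, hc₂⟩ := hgm m₂ (by simp [hm₂])
  obtain ⟨g₃, hl₃, hR₃, hmg₃, hc₃⟩ := hgm m₃ (by simp [hm₃])
  have hdisg : ∀ g g' : Set Pt, IsLine g → IsLine g' → R ∈ g → R ∈ g' → ∀ m m', m ∈ M → m' ∈ M →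
      m ≠ m' → m ∈ g → m' ∈ g' → ∀ x, x ∈ g → x ≠ R → x ∉ g' := by
    intro g g' hg hg' hRg hRg' m m' hm hm' hne hmg hmg' x hxg hxR hxg'
    have := hg.eq_of_mem hg' hxR hxg hRg hxg' hRg'
    subst this
    exact hRM (hg.eq_of_mem hM hne hmg hmg' hm hm' ▸ hRg)
  have hdl₁ := hdisg _ _ hs.line hl₁ hRl hR₁ P m₁ hPM hm₁.2.2 (Ne.symm hm₁.1) hPl hmg₁
  have hdl₂ := hdisg _ _ hs.line hl₂ hRl hR₂ P m₂ hPM hm₂.2.2 (Ne.symm hm₂.1) hPl hmg₂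
  have hdl₃ := hdisg _ _ hs.line hl₃ hRl hR₃ P m₃ hPM hm₃.2.2 (Ne.symm hm₃.1) hPl hmg₃
  have hd₁₂ := hdisg _ _ hl₁ hl₂ hR₁ hR₂ m₁ m₂ hm₁.2.2 hm₂.2.2 h12 hmg₁ hmg₂
  have hd₁₃ := hdisg _ _ hl₁ hl₃ hR₁ hR₃ m₁ m₃ hm₁.2.2 hm₃.2.2 h13 hmg₁ hmg₃
  have hd₂₃ := hdisg _ _ hl₂ hl₃ hR₂ hR₃ m₂ m₃ hm₂.2.2 hm₃.2.2 h23 hmg₂ hmg₃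
  have he : ∀ g, R ∈ g → (nodesOn X g).card = 3 → ((nodesOn X g).erase R).card = 2 := by
    intro g hRg h3
    rw [Finset.card_erase_of_mem (by simp [hRX, hRg]), h3]
  set U := nodesOn X ℓ ∪ ((nodesOn X g₁).erase R ∪
    ((nodesOn X g₂).erase R ∪ (nodesOn X g₃).erase R)) with hU
  have hUc : U.card = 9 := by
    rw [hU, Finset.card_union_of_disjoint, Finset.card_union_of_disjoint,
      Finset.card_union_of_disjoint, hs.card, he _ hR₁ hc₁, he _ hR₂ hc₂, he _ hR₃ hc₃]
    all_goals
      rw [Finset.disjoint_left]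
      intro x
      simp only [Finset.mem_union, Finset.mem_erase, mem_nodesOn]
      clear * - hdl₁ hdl₂ hdl₃ hd₁₂ hd₁₃ hd₂₃
      grind
  have hUmem : ∀ x, x ∈ U ↔ x ∈ X ∧ (x ∈ ℓ ∨ x ≠ R ∧ (x ∈ g₁ ∨ x ∈ g₂ ∨ x ∈ g₃)) := by
    intro x
    simp only [hU, Finset.mem_union, Finset.mem_erase, mem_nodesOn]
    tauto
  have hZ : (X \ U).card = 1 := by
    rw [Finset.card_sdiff_of_subset (fun x hx => ((hUmem x).mp hx).1), hX.card, hUc]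
  obtain ⟨z, hz⟩ := Finset.card_eq_one.mp hZ
  have hzm : ∀ x, x ∈ X ∧ x ∉ U ↔ x = z := by
    intro x; rw [← Finset.mem_sdiff, hz, Finset.mem_singleton]
  obtain ⟨hzX, hzU⟩ := (hzm z).mpr rfl
  rw [hUmem] at hzU
  push Not at hzU
  obtain ⟨hzl, hzg⟩ := hzU hzX
  have hzR : R ≠ z := by rintro rfl; exact hzl hRl
  have hzM : z ∉ M := by
    intro hzM
    have : z ≠ P := by rintro rfl; exact hzl hPl
    have h1 := (hmem z).mp ⟨this, hzX, hzM⟩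
    have h2 := hzg hzR.symm
    rcases h1 with rfl | rfl | rfl <;> tauto
  obtain ⟨γ, h, k, hc, hRγ⟩ := hX.exists_cov_mem hzX hRX hzR
  have hγM := hdisM z hzX hzM γ h k hRγ hc
  have hγ : ∀ x ∈ X, x ∈ γ → x = R := by
    intro x hx hxγ
    by_contra hxR
    have hxU : x ∈ U := by
      by_contra hxU
      have := (hzm x).mp ⟨hx, hxU⟩
      subst this
      exact hc.notMem₁ hxγ
    have key : ∀ g m, IsLine g → R ∈ g → x ∈ g → m ∈ X → m ∈ M → m ∈ g → False := by
      intro g m hg hRg hxg hm hmM hmg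
      apply hγM m hm hmM
      rwa [hc.line₁.eq_of_mem hg hxR hxγ hRγ hxg hRg]
    rcases (hUmem x).mp hxU with ⟨-, hx | ⟨-, hx | hx | hx⟩⟩
    · exact key ℓ P hs.line hRl hx hPX hPM hPl
    · exact key g₁ m₁ hl₁ hR₁ hx hm₁.2.1 hm₁.2.2 hmg₁
    · exact key g₂ m₂ hl₂ hR₂ hx hm₂.2.1 hm₂.2.2 hmg₂
    · exact key g₃ m₃ hl₃ hR₃ hx hm₃.2.1 hm₃.2.2 hmg₃
  have hγM' : γ ≠ M := by rintro rfl; exact hRM hRγ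
  obtain ⟨k, hc⟩ := hc.exists_cov_max hM hM4 hzM hγM'
  have hQz : Q ≠ z := by rintro rfl; exact hzl hQl
  have hQk := ((hc.cover Q hQX hQz).resolve_left (fun h => hQR (hγ Q hQX h))).resolve_left hQM
  have hk4 : (nodesOn X k).card ≠ 4 := by
    intro h4
    rw [only k hc.line₃ h4] at hQk
    exact hQM hQk
  have hγc : (nodesOn X γ).card ≤ 1 := by
    rw [Finset.card_le_one]
    intro x hx y hy
    rw [mem_nodesOn] at hx hy
    rw [hγ x hx.1 hx.2, hγ y hy.1 hy.2]
  have := hc.nine_le hX hzX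
  have := hX.card_le_four hc.line₃
  omega

end

section

variable {X : Finset Pt}

theorem eq_or_eq_of_three_mem {M L L' : Set Pt} (hM : IsLine M) (hL : IsLine L) (hL' : IsLine L')
    {x y z : Pt} (hxy : x ≠ y) (hxz : x ≠ z) (hyz : y ≠ z) (hx : x ∈ M) (hy : y ∈ M) (hz : z ∈ M)
    (hx' : x ∈ L ∨ x ∈ L') (hy' : y ∈ L ∨ y ∈ L') (hz' : z ∈ L ∨ z ∈ L') : L = M ∨ L' = M := by
  have h : ∀ {K u v}, IsLine K → u ≠ v → u ∈ M → v ∈ M → u ∈ K → v ∈ K → K = M :=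
    fun hK huv hu hv hu' hv' => hK.eq_of_mem hM huv hu' hv' hu hv
  rcases hx' with hx' | hx' <;> rcases hy' with hy' | hy'
  · exact .inl (h hL hxy hx hy hx' hy')
  · rcases hz' with hz' | hz'
    · exact .inl (h hL hxz hx hz hx' hz')
    · exact .inr (h hL' hyz hy hz hy' hz')
  · rcases hz' with hz' | hz'
    · exact .inl (h hL hyz hy hz hy' hz')
    · exact .inr (h hL' hxz hx hz hx' hz')
  · exact .inr (h hL' hxy hx hy hx' hy')

/-- The nodes of a `GC_3` set with exactly two maximal lines `M = {P, D, a, a'}` and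
`M' = {Q, D, b, b'}`, and a line `ℓ` through the nodes `P`, `Q` and `R`. -/
structure TwoMaxConfig (X : Finset Pt) (ℓ M M' : Set Pt) (P Q R D c c' a a' b b' : Pt) :
    Prop where
  gc : IsGCFinset X
  line : IsLine ℓ
  lineM : IsLine M
  lineM' : IsLine M'
  cardM : (nodesOn X M).card = 4
  cardM' : (nodesOn X M').card = 4
  only : ∀ L, IsLine L → (nodesOn X L).card = 4 → L = M ∨ L = M'
  nodup : [P, Q, R, D, c, c', a, a', b, b'].Nodup
  mem : ∀ x, x ∈ X ↔ x ∈ [P, Q, R, D, c, c', a, a', b, b']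
  memℓ : ∀ x ∈ [P, Q, R], x ∈ ℓ
  notMemℓ : ∀ x ∈ [D, c, c', a, a', b, b'], x ∉ ℓ
  memM : ∀ x ∈ [P, D, a, a'], x ∈ M
  notMemM : ∀ x ∈ [Q, R, c, c', b, b'], x ∉ M
  memM' : ∀ x ∈ [Q, D, b, b'], x ∈ M'
  notMemM' : ∀ x ∈ [P, R, c, c', a, a'], x ∉ M'

namespace TwoMaxConfig

variable {ℓ M M' : Set Pt} {P Q R D c c' a a' b b' : Pt}

theorem swap_c (hc : TwoMaxConfig X ℓ M M' P Q R D c c' a a' b b') :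
    TwoMaxConfig X ℓ M M' P Q R D c' c a a' b b' where
  __ := hc
  nodup := (((((List.Perm.swap c' c _).cons D).cons R).cons Q).cons P).nodup hc.nodup
  mem x := (hc.mem x).trans (((((List.Perm.swap c' c _).cons D).cons R).cons Q).cons P).mem_iff
  notMemℓ x hx := hc.notMemℓ x (by grind)
  notMemM x hx := hc.notMemM x (by grind)
  notMemM' x hx := hc.notMemM' x (by grind)

theorem swap_b (hc : TwoMaxConfig X ℓ M M' P Q R D c c' a a' b b') :
    TwoMaxConfig X ℓ M M' P Q R D c c' a a' b' b where
  __ := hc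
  nodup := ((List.Perm.swap b' b _).append_left [P, Q, R, D, c, c', a, a']).nodup hc.nodup
  mem x := (hc.mem x).trans
    ((List.Perm.swap b' b _).append_left [P, Q, R, D, c, c', a, a']).mem_iff
  notMemℓ x hx := hc.notMemℓ x (by grind)
  notMemM x hx := hc.notMemM x (by grind)
  memM' x hx := hc.memM' x (by grind)

theorem swap_max (hc : TwoMaxConfig X ℓ M M' P Q R D c c' a a' b b') :
    TwoMaxConfig X ℓ M' M Q P R D c c' b b' a a' where
  gc := hc.gc
  line := hc.line
  lineM := hc.lineM'
  lineM' := hc.lineM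
  cardM := hc.cardM'
  cardM' := hc.cardM
  only L hL h := (hc.only L hL h).symm
  nodup := ((List.Perm.swap Q P [R, D, c, c']).append
    (List.perm_append_comm (l₁ := [a, a']) (l₂ := [b, b']))).nodup hc.nodup
  mem x := (hc.mem x).trans ((List.Perm.swap Q P [R, D, c, c']).append
    (List.perm_append_comm (l₁ := [a, a']) (l₂ := [b, b']))).mem_iff
  memℓ x hx := hc.memℓ x (by grind)
  notMemℓ x hx := hc.notMemℓ x (by grind)
  memM := hc.memM'
  notMemM := hc.notMemM'
  memM' := hc.memM
  notMemM' := hc.notMemM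

theorem swap_a (hc : TwoMaxConfig X ℓ M M' P Q R D c c' a a' b b') :
    TwoMaxConfig X ℓ M M' P Q R D c c' a' a b b' :=
  hc.swap_max.swap_b.swap_max

theorem false_of_sublist (hc : TwoMaxConfig X ℓ M M' P Q R D c c' a a' b b') {L : Set Pt}
    (hL : IsLine L) {w x y z : Pt} (hw : w ∈ L) (hx : x ∈ L) (hy : y ∈ L) (hz : z ∈ L)
    (h : c ∈ L ∨ c' ∈ L)
    (hs : List.Sublist [w, x, y, z] [P, Q, R, D, c, c', a, a', b, b'] := by
      repeat' (first | exact List.nil_sublist _ | apply List.Sublist.cons_cons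
                     | apply List.Sublist.cons)) : False := by
  have h4 := four_le_card_nodesOn (hc.nodup.sublist hs)
    (fun v hv => (hc.mem v).mpr (hs.subset hv)) (L := L) (by simp [hw, hx, hy, hz])
  rcases hc.only L hL (le_antisymm (hc.gc.card_le_four hL) h4) with rfl | rfl
  · exact h.elim (hc.notMemM c (by simp)) (hc.notMemM c' (by simp))
  · exact h.elim (hc.notMemM' c (by simp)) (hc.notMemM' c' (by simp))

/-- The two lines used by `Q` besides `M` separate `b` and `b'`. -/
theorem exists_cov_Q (hc : TwoMaxConfig X ℓ M M' P Q R D c c' a a' b b') :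
    ∃ h k, Cov X Q M h k ∧ b ∈ h ∧ b' ∈ k ∧ b ∉ k ∧ b' ∉ h ∧ (R ∈ h ∨ R ∈ k) ∧
      (c ∈ h ∨ c ∈ k) ∧ (c' ∈ h ∨ c' ∈ k) := by
  have hM := hc.notMemM
  simp only [List.forall_mem_cons] at hM
  have hn := hc.nodup
  simp only [List.nodup_cons, List.mem_cons, not_or] at hn
  have hX := fun x => (hc.mem x).mpr
  have hM' := hc.memM'
  simp only [List.forall_mem_cons] at hM'
  obtain ⟨h, k, hk, h1, h2, h3, h4⟩ := hc.gc.exists_cov_separating hc.lineM' hc.lineM hc.cardM (hX Q (by simp))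
    (hX b (by simp)) (hX b' (by simp)) hM'.1 hM'.2.2.1 hM'.2.2.2.1 hM.1 hM.2.2.2.2.1 hM.2.2.2.2.2.1 (by tauto)
    (by tauto) (by tauto)
  exact ⟨h, k, hk, h1, h2, h3, h4, (hk.cover R (hX _ (by simp)) (by tauto)).resolve_left (by tauto),
    (hk.cover c (hX _ (by simp)) (by tauto)).resolve_left (by tauto),
    (hk.cover c' (hX _ (by simp)) (by tauto)).resolve_left (by tauto)⟩

/-- If `b` does not use `ℓ`, then the lines used by `b` besides `M` separate `Q` from both
`b'` and `R`. -/
theorem exists_cov_b (hc : TwoMaxConfig X ℓ M M' P Q R D c c' a a' b b')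
    (hb : ∀ h k, ¬ Cov X b ℓ h k) :
    ∃ h k, Cov X b M h k ∧ Q ∈ h ∧ b' ∈ k ∧ Q ∉ k ∧ b' ∉ h ∧ R ∈ k ∧
      (c ∈ h ∨ c ∈ k) ∧ (c' ∈ h ∨ c' ∈ k) := by
  have hM := hc.notMemM
  simp only [List.forall_mem_cons] at hM
  have hn := hc.nodup
  simp only [List.nodup_cons, List.mem_cons, not_or] at hn
  have hX := fun x => (hc.mem x).mpr
  have hM' := hc.memM'
  simp only [List.forall_mem_cons] at hM'
  obtain ⟨h, k, hk, h1, h2, h3, h4⟩ := hc.gc.exists_cov_separating hc.lineM' hc.lineM hc.cardM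
    (hX b (by simp)) (hX Q (by simp)) (hX b' (by simp)) hM'.2.2.1 hM'.1 hM'.2.2.2.1 hM.2.2.2.2.1 hM.1 hM.2.2.2.2.2.1 (by tauto)
    (by tauto) (by tauto)
  have hRh : R ∉ h := by
    intro hR
    refine hb M k ?_
    rw [hc.line.eq_of_mem hk.line₂ hn.2.1.1 (hc.memℓ Q (by simp)) (hc.memℓ R (by simp)) h1 hR]
    exact hk.swap₁₂
  exact ⟨h, k, hk, h1, h2, h3, h4,
    ((hk.cover R (hX _ (by simp)) (by tauto)).resolve_left (by tauto)).resolve_left hRh,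
    (hk.cover c (hX _ (by simp)) (by tauto)).resolve_left (by tauto),
    (hk.cover c' (hX _ (by simp)) (by tauto)).resolve_left (by tauto)⟩

theorem false_of_cov_a_of_line (hc : TwoMaxConfig X ℓ M M' P Q R D c c' a a' b b')
    (huse : ∀ B ∈ X, ∀ h k, Cov X B ℓ h k → B = a) {h K : Set Pt} (hK : Cov X a ℓ M' K)
    (hl : IsLine h) (hRh : R ∈ h) (hbh : b ∈ h) (hch : c ∈ h) : False := by
  have hn := hc.nodup
  simp only [List.nodup_cons, List.mem_cons, not_or] at hn
  obtain ⟨⟨hPQ, hPR, hPD, -, -, hPa, hPa', -⟩, ⟨hQR, hQD, hQc, -, -, -, hQb, hQb', -⟩,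
    ⟨hRD, hRc, hRc', hRa, hRa', hRb, hRb', -⟩, ⟨-, -, hDa, hDa', hDb, hDb', -⟩,
    ⟨hcc', hca, -⟩, ⟨hca', -⟩, ⟨haa', hab, -⟩, -, ⟨hbb', -⟩, -⟩ := hn
  have hKm : ∀ x ∈ X, x ≠ a → x ∉ ℓ → x ∉ M' → x ∈ K := fun x hx hxa h1 h2 =>
    ((hK.cover x hx hxa).resolve_left h1).resolve_left h2
  have hX := fun x => (hc.mem x).mpr
  have hcK := hKm c (hX _ (by simp)) hca (hc.notMemℓ _ (by simp)) (hc.notMemM' _ (by simp))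
  have hcK' := hKm c' (hX _ (by simp)) hca' (hc.notMemℓ _ (by simp)) (hc.notMemM' _ (by simp))
  have haK' := hKm a' (hX _ (by simp)) (Ne.symm haa') (hc.notMemℓ _ (by simp))
    (hc.notMemM' _ (by simp))
  obtain ⟨h', k', hk', hQh', hbk', -, -, hRk', hch', hck'⟩ := hc.exists_cov_b fun h k hk =>
    hab (huse b (hX _ (by simp)) h k hk).symm
  have hc1 : c ∉ k' := fun hck => hk'.notMem₃ <| by
    rwa [hk'.line₃.eq_of_mem hl hRc hRk' hck hRh hch]
  have hc2 : c' ∉ h' := fun hch2 => by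
    have : h' = K := hk'.line₂.eq_of_mem hK.line₃ hcc' (by tauto) hch2 hcK hcK'
    subst this
    exact hc.false_of_sublist hK.line₃ hQh' hcK hcK' haK' (.inl hcK)
  have hc3 : c' ∈ k' := by tauto
  obtain ⟨L₁, L₂, L₃, hL, hRL⟩ := hc.gc.exists_cov_mem (hX D (by simp)) (hX R (by simp)) (by tauto)
  have hLℓ : L₁ ≠ ℓ := by
    rintro rfl
    exact hDa (huse D (hX _ (by simp)) _ _ hL)
  have key : ∀ N x y z, IsLine N → D ∈ N → x ≠ y → x ≠ z → y ≠ z → D ≠ x → D ≠ y → D ≠ z →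
      x ∈ X → y ∈ X → z ∈ X → x ∈ N → y ∈ N → z ∈ N → x ∈ L₁ ∨ y ∈ L₁ ∨ z ∈ L₁ := by
    intro N x y z hN hDN hxy hxz hyz hDx hDy hDz hxX hyX hzX hx hy hz
    by_contra! hno
    rcases eq_or_eq_of_three_mem hN hL.line₂ hL.line₃ hxy hxz hyz hx hy hz
      ((hL.cover x hxX hDx.symm).resolve_left hno.1)
      ((hL.cover y hyX hDy.symm).resolve_left hno.2.1)
      ((hL.cover z hzX hDz.symm).resolve_left hno.2.2) with rfl | rfl
    · exact hL.notMem₂ hDN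
    · exact hL.notMem₃ hDN
  have hQL : Q ∉ L₁ := fun hQ => hLℓ <|
    hL.line₁.eq_of_mem hc.line hQR hQ hRL (hc.memℓ _ (by simp)) (hc.memℓ _ (by simp))
  have hPL : P ∉ L₁ := fun hP => hLℓ <|
    hL.line₁.eq_of_mem hc.line hPR hP hRL (hc.memℓ _ (by simp)) (hc.memℓ _ (by simp))
  have hM := (key M P a a' hc.lineM (hc.memM _ (by simp)) hPa hPa' haa' (Ne.symm hPD) hDa hDa'
    (hX _ (by simp)) (hX _ (by simp)) (hX _ (by simp)) (hc.memM _ (by simp)) (hc.memM _ (by simp))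
    (hc.memM _ (by simp))).resolve_left hPL
  have hM' := (key M' Q b b' hc.lineM' (hc.memM' _ (by simp)) (by tauto) (by tauto) (by tauto)
    (Ne.symm hQD) (by tauto) (by tauto)
    (hX _ (by simp)) (hX _ (by simp)) (hX _ (by simp)) (hc.memM' _ (by simp))
    (hc.memM' _ (by simp)) (hc.memM' _ (by simp))).resolve_left hQL
  rcases hM' with hbL | hbL
  · have : L₁ = h := hL.line₁.eq_of_mem hl (by tauto) hRL hbL hRh hbh
    subst this
    rcases hM with haL | haL
    · exact hc.false_of_sublist hl hRh hch haL hbh (.inl hch)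
    · exact hc.false_of_sublist hl hRh hch haL hbh (.inl hch)
  · have : L₁ = k' := hL.line₁.eq_of_mem hk'.line₃ (by tauto) hRL hbL hRk' hbk'
    subst this
    rcases hM with haL | haL
    · exact hc.false_of_sublist hL.line₁ hRL hc3 haL hbL (.inr hc3)
    · exact hc.false_of_sublist hL.line₁ hRL hc3 haL hbL (.inr hc3)

theorem false_of_cov_a (hc : TwoMaxConfig X ℓ M M' P Q R D c c' a a' b b')
    (huse : ∀ B ∈ X, ∀ h k, Cov X B ℓ h k → B = a) {h k : Set Pt} (hK : Cov X a ℓ h k) :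
    False := by
  have hX := fun x => (hc.mem x).mpr
  have hn := hc.nodup
  simp only [List.nodup_cons, List.mem_cons, not_or] at hn
  obtain ⟨-, -, -, -, ⟨hcc', hca, -⟩, ⟨hca', -⟩, ⟨haa', -⟩, -⟩ := hn
  obtain ⟨K, hK⟩ := hK.exists_cov_max hc.lineM' hc.cardM' (hc.notMemM' a (by simp)) <| by
    rintro rfl
    exact hc.notMemM' P (by simp) (hc.memℓ P (by simp))
  have hKm : ∀ x ∈ X, x ≠ a → x ∉ ℓ → x ∉ M' → x ∈ K := fun x hx hxa h1 h2 =>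
    ((hK.cover x hx hxa).resolve_left h1).resolve_left h2
  have hcK := hKm c (hX _ (by simp)) hca (hc.notMemℓ _ (by simp)) (hc.notMemM' _ (by simp))
  have hcK' := hKm c' (hX _ (by simp)) hca' (hc.notMemℓ _ (by simp))
    (hc.notMemM' _ (by simp))
  have haK' := hKm a' (hX _ (by simp)) (Ne.symm haa') (hc.notMemℓ _ (by simp))
    (hc.notMemM' _ (by simp))
  have both : ∀ N, IsLine N → c ∈ N → c' ∈ N → (b ∈ N ∨ b' ∈ N) → False := by
    intro N hN h1 h2 h3
    have : N = K := hN.eq_of_mem hK.line₃ hcc' h1 h2 hcK hcK'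
    subst this
    rcases h3 with h3 | h3
    · exact hc.false_of_sublist hN h1 h2 haK' h3 (.inl h1)
    · exact hc.false_of_sublist hN h1 h2 haK' h3 (.inl h1)
  obtain ⟨h, k, hk, hbh, hbk, -, -, hR, hch, hck⟩ := hc.exists_cov_Q
  have hh := fun h1 h2 => both h hk.line₂ h1 h2 (.inl hbh)
  have hk' := fun h1 h2 => both k hk.line₃ h1 h2 (.inr hbk)
  rcases hR with hR | hR
  · by_cases h1 : c ∈ h
    · exact hc.false_of_cov_a_of_line huse hK hk.line₂ hR hbh h1
    · exact hc.swap_c.false_of_cov_a_of_line huse hK hk.line₂ hR hbh (by tauto)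
  · by_cases h1 : c ∈ k
    · exact hc.swap_b.false_of_cov_a_of_line huse hK hk.line₃ hR hbk h1
    · exact hc.swap_b.swap_c.false_of_cov_a_of_line huse hK hk.line₃ hR hbk (by tauto)

theorem mem_of_mem_or_mem (hc : TwoMaxConfig X ℓ M M' P Q R D c c' a a' b b') {L₁ L₂ h k : Set Pt}
    (h₁ : IsLine L₁) (h₂ : IsLine L₂) (ha : a ∈ L₁) (hb : b ∈ L₁) (hc₁ : c ∈ L₁) (ha' : a' ∈ L₂)
    (hb' : b' ∈ L₂) (hc₂ : c' ∈ L₂) (hh : IsLine h) (hk : IsLine k) (hbh : b ∈ h) (hbk : b' ∈ k)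
    (hch : c ∈ h ∨ c ∈ k) (hch' : c' ∈ h ∨ c' ∈ k) (hR : R ∈ h) : c' ∈ h := by
  have hn := hc.nodup
  simp only [List.nodup_cons, List.mem_cons, not_or] at hn
  obtain ⟨-, -, -, -, ⟨-, -, -, hcb, -⟩, ⟨-, -, -, hcb', -⟩, -⟩ := hn
  refine hch'.resolve_right fun hck' => ?_
  rcases hch with hch | hck
  · rw [hh.eq_of_mem h₁ hcb hch hbh hc₁ hb] at hR
    exact hc.false_of_sublist h₁ hR hc₁ ha hb (.inl hc₁)
  · rw [hk.eq_of_mem h₂ hcb' hck' hbk hc₂ hb'] at hck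
    exact hc.false_of_sublist h₂ hck hc₂ ha' hb' (.inl hck)

theorem exists_collinear (hc : TwoMaxConfig X ℓ M M' P Q R D c c' a a' b b') {L₁ L₂ : Set Pt}
    (h₁ : IsLine L₁) (h₂ : IsLine L₂) (ha : a ∈ L₁) (hb : b ∈ L₁) (hc₁ : c ∈ L₁) (ha' : a' ∈ L₂)
    (hb' : b' ∈ L₂) (hc₂ : c' ∈ L₂) :
    (∃ h, IsLine h ∧ R ∈ h ∧ b ∈ h ∧ c' ∈ h) ∨ ∃ h, IsLine h ∧ R ∈ h ∧ b' ∈ h ∧ c ∈ h := by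
  obtain ⟨h, k, hk, hbh, hbk, -, -, hR, hch, hch'⟩ := hc.exists_cov_Q
  rcases hR with hR | hR
  · exact .inl ⟨h, hk.line₂, hR, hbh, hc.mem_of_mem_or_mem h₁ h₂ ha hb hc₁ ha' hb' hc₂ hk.line₂
      hk.line₃ hbh hbk hch hch' hR⟩
  · exact .inr ⟨k, hk.line₃, hR, hbk, hc.swap_a.swap_b.swap_c.mem_of_mem_or_mem h₂ h₁ ha' hb' hc₂ ha
      hb hc₁ hk.line₃ hk.line₂ hbk hbh hch'.symm hch.symm hR⟩

theorem false_of_collinear (hc : TwoMaxConfig X ℓ M M' P Q R D c c' a a' b b')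
    (huse : ∀ B ∈ X, ∀ h k, Cov X B ℓ h k → B = D) {L₁ L₂ h : Set Pt}
    (h₁ : IsLine L₁) (h₂ : IsLine L₂) (ha : a ∈ L₁) (hb : b ∈ L₁) (hc₁ : c ∈ L₁) (ha' : a' ∈ L₂)
    (hb' : b' ∈ L₂) (hc₂ : c' ∈ L₂) (hh : IsLine h) (hRh : R ∈ h) (hah : a ∈ h) (hch : c' ∈ h) :
    False := by
  have hn := hc.nodup
  simp only [List.nodup_cons, List.mem_cons, not_or] at hn
  obtain ⟨⟨hPQ, -⟩, -, ⟨-, hRc, hRc', -⟩, ⟨-, -, hDa, -, -, hDb', -⟩, ⟨hcc', -⟩, -⟩ := hn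
  have hX := fun x => (hc.mem x).mpr
  rcases hc.exists_collinear h₁ h₂ ha hb hc₁ ha' hb' hc₂ with ⟨g, hg, hRg, hbg, hcg⟩ |
    ⟨g, hg, hRg, hbg, hcg⟩
  · rw [hg.eq_of_mem hh hRc' hRg hcg hRh hch] at hbg
    exact hc.false_of_sublist hh hRh hch hah hbg (.inr hch)
  obtain ⟨h₃, k₃, hk₃, hP, ha₃, -, -, hR₃, hc₃, hc₃'⟩ := hc.swap_max.exists_cov_b fun h k hk =>
    hDa (huse a (hX _ (by simp)) h k hk).symm
  obtain ⟨h₄, k₄, hk₄, hQ, hb₄, -, -, hR₄, hc₄, hc₄'⟩ := hc.swap_b.exists_cov_b fun h k hk =>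
    hDb' (huse b' (hX _ (by simp)) h k hk).symm
  have e₃ : c ∈ h₃ := hc₃.resolve_right fun hck => by
    rw [hk₃.line₃.eq_of_mem hg hRc hR₃ hck hRg hcg] at ha₃
    exact hc.false_of_sublist hg hRg hcg ha₃ hbg (.inl hcg)
  have e₃' : c' ∈ h₃ := hc₃'.resolve_right fun hck => hk₃.notMem₃ <| by
    rwa [hk₃.line₃.eq_of_mem hh hRc' hR₃ hck hRh hch]
  have e₄ : c' ∈ h₄ := hc₄'.resolve_right fun hck => by
    rw [hk₄.line₃.eq_of_mem hh hRc' hR₄ hck hRh hch] at hb₄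
    exact hc.false_of_sublist hh hRh hch hah hb₄ (.inr hch)
  have e₄' : c ∈ h₄ := hc₄.resolve_right fun hck => hk₄.notMem₃ <| by
    rwa [hk₄.line₃.eq_of_mem hg hRc hR₄ hck hRg hcg]
  rw [hk₄.line₂.eq_of_mem hk₃.line₂ hcc' e₄' e₄ e₃ e₃'] at hQ
  refine hc.notMemℓ c (by simp) ?_
  rwa [hc.line.eq_of_mem hk₃.line₂ hPQ (hc.memℓ _ (by simp)) (hc.memℓ _ (by simp)) hP hQ]

theorem false_of_cov_D_of_mem (hc : TwoMaxConfig X ℓ M M' P Q R D c c' a a' b b')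
    (huse : ∀ B ∈ X, ∀ h k, Cov X B ℓ h k → B = D) {L₁ L₂ : Set Pt}
    (h₁ : IsLine L₁) (h₂ : IsLine L₂) (ha : a ∈ L₁) (hb : b ∈ L₁) (hc₁ : c ∈ L₁) (ha' : a' ∈ L₂)
    (hb' : b' ∈ L₂) (hc₂ : c' ∈ L₂) : False := by
  rcases hc.swap_max.exists_collinear h₁ h₂ hb ha hc₁ hb' ha' hc₂ with ⟨g, hg, hRg, hag, hcg⟩ |
    ⟨g, hg, hRg, hag, hcg⟩
  · exact hc.false_of_collinear huse h₁ h₂ ha hb hc₁ ha' hb' hc₂ hg hRg hag hcg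
  · exact hc.swap_a.swap_b.swap_c.false_of_collinear huse h₂ h₁ ha' hb' hc₂ ha hb hc₁ hg hRg hag hcg

theorem false_of_cov_D (hc : TwoMaxConfig X ℓ M M' P Q R D c c' a a' b b')
    (huse : ∀ B ∈ X, ∀ h k, Cov X B ℓ h k → B = D) {L₁ L₂ : Set Pt} (hD : Cov X D ℓ L₁ L₂) :
    False := by
  have hn := hc.nodup
  simp only [List.nodup_cons, List.mem_cons, not_or] at hn
  obtain ⟨-, -, -, ⟨hDc, hDc', hDa, hDa', hDb, hDb', -⟩, -, -, ⟨haa', -⟩, -, ⟨hbb', -⟩, -⟩ := hn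
  have hX := fun x => (hc.mem x).mpr
  wlog hb : b ∈ L₁ generalizing L₁ L₂
  · exact this hD.swap₂₃ (((hD.cover b (hX _ (by simp)) (Ne.symm hDb)).resolve_left
      (hc.notMemℓ _ (by simp))).resolve_left hb)
  have hmem : ∀ x, x ∈ [P, Q, R, D, c, c', a, a', b, b'] → D ≠ x → x ∉ ℓ → x ∈ L₁ ∨ x ∈ L₂ :=
    fun x hx hne hxl => (hD.cover x (hX _ hx) hne.symm).resolve_left hxl
  have hsep : ∀ L, IsLine L → D ∉ L → ¬ (a ∈ L ∧ a' ∈ L) ∧ ¬ (b ∈ L ∧ b' ∈ L) := by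
    refine fun L hL hDL => ⟨fun h => hDL ?_, fun h => hDL ?_⟩
    · rw [hL.eq_of_mem hc.lineM haa' h.1 h.2 (hc.memM _ (by simp)) (hc.memM _ (by simp))]
      exact hc.memM _ (by simp)
    · rw [hL.eq_of_mem hc.lineM' hbb' h.1 h.2 (hc.memM' _ (by simp)) (hc.memM' _ (by simp))]
      exact hc.memM' _ (by simp)
  have s₁ := hsep L₁ hD.line₂ hD.notMem₂
  have s₂ := hsep L₂ hD.line₃ hD.notMem₃
  have ma := hmem a (by simp) hDa (hc.notMemℓ _ (by simp))
  have ma' := hmem a' (by simp) hDa' (hc.notMemℓ _ (by simp))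
  have mb' : b' ∈ L₂ := (hmem b' (by simp) hDb' (hc.notMemℓ _ (by simp))).resolve_left
    fun h => s₁.2 ⟨hb, h⟩
  have mc := hmem c (by simp) hDc (hc.notMemℓ _ (by simp))
  have mc' := hmem c' (by simp) hDc' (hc.notMemℓ _ (by simp))
  clear hmem hsep hDc hDc' hDa hDa' hDb hDb' haa' hbb' hX
  wlog ha : a ∈ L₁ generalizing a a'
  · exact this hc.swap_a (by tauto) (by tauto) ma' ma (by tauto)
  have ha' : a' ∈ L₂ := by tauto
  have n₁ : ¬ (c ∈ L₁ ∧ c' ∈ L₁) := fun h =>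
    hc.false_of_sublist hD.line₂ h.1 h.2 ha hb (.inl h.1)
  have n₂ : ¬ (c ∈ L₂ ∧ c' ∈ L₂) := fun h =>
    hc.false_of_sublist hD.line₃ h.1 h.2 ha' mb' (.inl h.1)
  rcases mc with mc | mc
  · exact hc.false_of_cov_D_of_mem huse hD.line₂ hD.line₃ ha hb mc ha' mb' (by tauto)
  · exact hc.swap_c.false_of_cov_D_of_mem huse hD.line₂ hD.line₃ ha hb (by tauto) ha' mb' mc

end TwoMaxConfig

end

section

variable {X : Finset Pt} {ℓ : Set Pt} {A : Pt}

theorem SoleUser.false_of_two_max (hs : SoleUser X ℓ A) {M M' : Set Pt}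
    (hM : IsLine M) (hM4 : (nodesOn X M).card = 4) (hM' : IsLine M')
    (hM4' : (nodesOn X M').card = 4) (hne : M ≠ M')
    (only : ∀ L, IsLine L → (nodesOn X L).card = 4 → L = M ∨ L = M') : False := by
  classical
  obtain ⟨P, hPX, hPM, hPl⟩ := hs.exists_mem_of_max hM hM4
  obtain ⟨Q, hQX, hQM, hQl⟩ := hs.exists_mem_of_max hM' hM4'
  obtain ⟨D, hDX, hDM, hDM'⟩ := hs.gc.exists_mem_of_max hM hM4 hM' hM4' hne
  have ul : ∀ x ∈ X, x ∈ ℓ → x ∈ M → x = P := fun x hx hxl hxM => by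
    by_contra hxP
    exact hs.ne_of_max hM4 (hs.line.eq_of_mem hM hxP hxl hPl hxM hPM)
  have ul' : ∀ x ∈ X, x ∈ ℓ → x ∈ M' → x = Q := fun x hx hxl hxM => by
    by_contra hxQ
    exact hs.ne_of_max hM4' (hs.line.eq_of_mem hM' hxQ hxl hQl hxM hQM)
  have uD : ∀ x ∈ X, x ∈ M → x ∈ M' → x = D := fun x hx hxM hxM' => by
    by_contra hxD
    exact hne (hM.eq_of_mem hM' hxD hxM hDM hxM' hDM')
  have hl : ∀ x ∈ X, x ∈ ℓ → x ∈ M → x ∉ M' := fun x hx hxl hxM hxM' =>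
    hne (hs.eq_of_mem _ _ hM hM4 hM' hM4' x hx hxl hxM hxM')
  have hPQ : P ≠ Q := by rintro rfl; exact hl P hPX hPl hPM hQM
  have hPD : P ≠ D := by rintro rfl; exact hl P hPX hPl hPM hDM'
  have hQD : Q ≠ D := by rintro rfl; exact hl Q hQX hQl hDM hQM
  obtain ⟨R, hRX, hRl, hPR, hQR, hPQR⟩ : ∃ R ∈ X, R ∈ ℓ ∧ P ≠ R ∧ Q ≠ R ∧
      ∀ x ∈ X, x ∈ ℓ → x = P ∨ x = Q ∨ x = R := by
    obtain ⟨Q', R, hQX', hRX, hQl', hRl, hPQ', hPR, hQR, hm⟩ :=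
      exists_pair_of_card_three hs.card hPX hPl
    rcases hm Q hQX hQl with h | rfl | rfl
    · exact absurd h.symm hPQ
    · exact ⟨R, hRX, hRl, hPR, hQR, hm⟩
    · exact ⟨Q', hQX', hQl', hPQ', hQR.symm, fun x hx hxl => by have := hm x hx hxl; tauto⟩
  obtain ⟨a, a', haX, haX', haM, haM', hPa, hPa', hDa, hDa', haa, hma⟩ :=
    exists_pair_of_card_four hM4 hPX hPM hDX hDM hPD
  obtain ⟨b, b', hbX, hbX', hbM, hbM', hQb, hQb', hDb, hDb', hbb, hmb⟩ :=
    exists_pair_of_card_four hM4' hQX hQM hDX hDM' hQD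
  have hRM : R ∉ M := fun h => hPR (ul R hRX hRl h).symm
  have hRM' : R ∉ M' := fun h => hQR (ul' R hRX hRl h).symm
  have hPM' : P ∉ M' := hl P hPX hPl hPM
  have hQM' : Q ∉ M := fun h => hl Q hQX hQl h hQM
  have ha1 : a ∉ M' := fun h => hDa (uD a haX haM h).symm
  have ha1' : a' ∉ M' := fun h => hDa' (uD a' haX' haM' h).symm
  have hb1 : b ∉ M := fun h => hDb (uD b hbX h hbM).symm
  have hb1' : b' ∉ M := fun h => hDb' (uD b' hbX' h hbM').symm
  have ha2 : a ∉ ℓ := fun h => hPa (ul a haX h haM).symm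
  have ha2' : a' ∉ ℓ := fun h => hPa' (ul a' haX' h haM').symm
  have hb2 : b ∉ ℓ := fun h => hQb (ul' b hbX h hbM).symm
  have hb2' : b' ∉ ℓ := fun h => hQb' (ul' b' hbX' h hbM').symm
  have hDl : D ∉ ℓ := fun h => hPD (ul D hDX h hDM).symm
  have hn : [P, Q, R, D, a, a', b, b'].Nodup := by
    have key : ∀ {x y : Pt} {S : Set Pt}, x ∈ S → y ∉ S → x ≠ y :=
      fun hx hy h => hy (h ▸ hx)
    simp only [List.nodup_cons, List.mem_cons, not_or, List.not_mem_nil, not_false_eq_true,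
      List.nodup_nil, and_true]
    exact ⟨⟨hPQ, hPR, hPD, hPa, hPa', key hPl hb2, key hPl hb2'⟩,
      ⟨hQR, hQD, key hQl ha2, key hQl ha2', hQb, hQb'⟩,
      ⟨key hRl hDl, key hRl ha2, key hRl ha2', key hRl hb2, key hRl hb2'⟩,
      ⟨hDa, hDa', hDb, hDb'⟩, ⟨haa, key haM hb1, key haM hb1'⟩, ⟨key haM' hb1, key haM' hb1'⟩, hbb⟩
  have hsub : [P, Q, R, D, a, a', b, b'].toFinset ⊆ X := by
    intro x hx
    simp only [List.mem_toFinset, List.mem_cons, List.not_mem_nil, or_false] at hx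
    rcases hx with rfl | rfl | rfl | rfl | rfl | rfl | rfl | rfl <;> assumption
  have hcard : (X \ [P, Q, R, D, a, a', b, b'].toFinset).card = 2 := by
    rw [Finset.card_sdiff_of_subset hsub, hs.gc.card, List.toFinset_card_of_nodup hn]; rfl
  obtain ⟨c, c', hcc, hcX⟩ := Finset.card_eq_two.mp hcard
  have hcm : ∀ x, (x ∈ X ∧ x ∉ [P, Q, R, D, a, a', b, b']) ↔ x = c ∨ x = c' := by
    intro x
    rw [← List.mem_toFinset, ← Finset.mem_sdiff, hcX]; simp
  have hoff : ∀ x, x = c ∨ x = c' → x ∉ ℓ ∧ x ∉ M ∧ x ∉ M' := by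
    intro x hx
    obtain ⟨hxX, hxn⟩ := (hcm x).mpr hx
    simp only [List.mem_cons, List.not_mem_nil, or_false] at hxn
    refine ⟨fun h => ?_, fun h => ?_, fun h => ?_⟩
    · have := hPQR x hxX h; clear * - this hxn; tauto
    · have := hma x hxX h; clear * - this hxn; tauto
    · have := hmb x hxX h; clear * - this hxn; tauto
  obtain ⟨hc1, hc2, hc3⟩ := hoff c (.inl rfl)
  obtain ⟨hd1, hd2, hd3⟩ := hoff c' (.inr rfl)
  have hperm : List.Perm ([P, Q, R, D, a, a', b, b'] ++ [c, c']) [P, Q, R, D, c, c', a, a', b, b'] :=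
    (List.perm_append_comm (l₁ := [a, a', b, b']) (l₂ := [c, c'])).append_left [P, Q, R, D]
  have hconf : TwoMaxConfig X ℓ M M' P Q R D c c' a a' b b' := by
    refine ⟨hs.gc, hs.line, hM, hM', hM4, hM4', only, ?_, ?_, ?_, ?_, ?_, ?_, ?_, ?_⟩
    · refine hperm.nodup (List.nodup_append'.mpr ⟨hn, by simpa using hcc, ?_⟩)
      intro x hx hx'
      exact ((hcm x).mpr (by simpa using hx')).2 hx
    · intro x
      rw [← hperm.mem_iff, List.mem_append]
      by_cases hx : x ∈ [P, Q, R, D, a, a', b, b']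
      · exact ⟨fun _ => .inl hx, fun _ => hsub (List.mem_toFinset.mpr hx)⟩
      · exact ⟨fun h => .inr (by simpa using (hcm x).mp ⟨h, hx⟩),
          fun h => ((hcm x).mpr (by simpa using h.resolve_left hx)).1⟩
    · simp [hPl, hQl, hRl]
    · simp [hDl, hc1, hd1, ha2, ha2', hb2, hb2']
    · simp [hPM, hDM, haM, haM']
    · simp [hQM', hRM, hc2, hd2, hb1, hb1']
    · simp [hQM, hDM', hbM, hbM']
    · simp [hPM', hRM', hc3, hd3, ha1, ha1']
  obtain ⟨h, k, hA⟩ := hs.cov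
  rcases hs.mem_or_mem hM hM4 hM' hM4' hne with hAM | hAM
  · rcases hma A hs.mem hAM with rfl | rfl | rfl | rfl
    · exact hA.notMem₁ hPl
    · exact hconf.false_of_cov_D hs.eq_of_cov hA
    · exact hconf.false_of_cov_a hs.eq_of_cov hA
    · exact hconf.swap_a.false_of_cov_a hs.eq_of_cov hA
  · rcases hmb A hs.mem hAM with rfl | rfl | rfl | rfl
    · exact hA.notMem₁ hQl
    · exact hconf.false_of_cov_D hs.eq_of_cov hA
    · exact hconf.swap_max.false_of_cov_a hs.eq_of_cov hA
    · exact hconf.swap_max.swap_a.false_of_cov_a hs.eq_of_cov hA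

theorem exists_of_card_four {L : Set Pt} (h : (nodesOn X L).card = 4) {x y z : Pt} (hx : x ∈ X)
    (hxL : x ∈ L) (hy : y ∈ X) (hyL : y ∈ L) (hz : z ∈ X) (hzL : z ∈ L) (hxy : x ≠ y)
    (hxz : x ≠ z) (hyz : y ≠ z) : ∃ w ∈ X, w ∈ L ∧ x ≠ w ∧ y ≠ w ∧ z ≠ w ∧
      ∀ v ∈ X, v ∈ L → v = x ∨ v = y ∨ v = z ∨ v = w := by
  obtain ⟨a, b, ha, hb, haL, hbL, hxa, hxb, hya, hyb, hab, hm⟩ :=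
    exists_pair_of_card_four h hx hxL hy hyL hxy
  rcases hm z hz hzL with h | h | rfl | rfl
  · exact absurd h.symm hxz
  · exact absurd h.symm hyz
  · exact ⟨b, hb, hbL, hxb, hyb, hab, hm⟩
  · exact ⟨a, ha, haL, hxa, hya, hab.symm, fun v hv hvL => by have := hm v hv hvL; tauto⟩

theorem SoleUser.exists_collinear (hs : SoleUser X ℓ A) {M₁ M₂ M₃ k : Set Pt} (h₁ : IsLine M₁)
    (h₂ : IsLine M₂) (h₂4 : (nodesOn X M₂).card = 4) (h₃ : IsLine M₃)
    (h₃4 : (nodesOn X M₃).card = 4) (hk : IsLine k) {P R s e₁ e₂ e₃ C : Pt}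
    (hP : P ∈ X) (hR : R ∈ X) (hsX : s ∈ X) (he₁ : e₁ ∈ X) (he₂ : e₂ ∈ X) (he₃ : e₃ ∈ X)
    (hC : C ∈ X) (hPl : P ∈ ℓ) (hRl : R ∈ ℓ) (hPR : P ≠ R) (hP₁ : P ∈ M₁) (hs₁ : s ∈ M₁)
    (he₁₁ : e₁ ∈ M₁) (hR₃ : R ∈ M₃) (hs₃ : s ∈ M₃) (he₃₃ : e₃ ∈ M₃) (hsP : s ≠ P) (hse₁ : s ≠ e₁)
    (hPe₁ : P ≠ e₁) (hsR : s ≠ R) (hse₃ : s ≠ e₃) (hRe₃ : R ≠ e₃) (hP₂ : P ∉ M₂) (hs₂ : s ∉ M₂)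
    (he₁₂ : e₁ ∉ M₂) (hR₂ : R ∉ M₂) (he₃₂ : e₃ ∉ M₂) (he₂₂ : e₂ ∈ M₂) (he₁₃ : e₁ ∉ M₃)
    (hC₁ : C ∉ M₁) (hC₂ : C ∉ M₂) (hC₃ : C ∉ M₃) (hsA : s ≠ A) (he₁k : e₁ ∈ k) (he₂k : e₂ ∈ k)
    (hCk : C ∈ k) : ∃ h, IsLine h ∧ P ∈ h ∧ e₃ ∈ h ∧ C ∈ h := by
  have key : ∀ {x y : Pt} {S : Set Pt}, x ∈ S → y ∉ S → x ≠ y := fun hx hy h => hy (h ▸ hx)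
  obtain ⟨h, g, hc⟩ := hs.gc.exists_cov_max hsX h₂ h₂4 hs₂
  wlog hPh : P ∈ h generalizing h g
  · exact this g h hc.swap₂₃ (((hc.cover P hP hsP.symm).resolve_left hP₂).resolve_left hPh)
  have he₁h : e₁ ∉ h := fun he => hc.notMem₂ <| by
    rwa [hc.line₂.eq_of_mem h₁ hPe₁ hPh he hP₁ he₁₁]
  have hRh : R ∉ h := fun hRh => hsA <| hs.eq_of_cov s hsX M₂ g <| by
    rw [hs.line.eq_of_mem hc.line₂ hPR hPl hRl hPh hRh]
    exact hc.swap₁₂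
  have he₁g : e₁ ∈ g := ((hc.cover e₁ he₁ hse₁.symm).resolve_left he₁₂).resolve_left he₁h
  have hRg : R ∈ g := ((hc.cover R hR hsR.symm).resolve_left hR₂).resolve_left hRh
  have he₃g : e₃ ∉ g := fun he => hc.notMem₃ <| by
    rwa [hc.line₃.eq_of_mem h₃ hRe₃ hRg he hR₃ he₃₃]
  refine ⟨h, hc.line₂, hPh, ((hc.cover e₃ he₃ hse₃.symm).resolve_left he₃₂).resolve_right he₃g,
    ((hc.cover C hC (key hs₁ hC₁).symm).resolve_left hC₂).resolve_right fun hCg => hC₃ ?_⟩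
  have hgk := hc.line₃.eq_of_mem hk (key he₁₁ hC₁) he₁g hCg he₁k hCk
  have h4 : 4 ≤ (nodesOn X g).card := by
    refine four_le_card_nodesOn (w := R) (x := e₁) (y := e₂) (z := C) ?_ ?_ ?_
    · simp [key hR₃ he₁₃, (key he₂₂ hR₂).symm, key hR₃ hC₃, (key he₂₂ he₁₂).symm, key he₁₁ hC₁,
        key he₂₂ hC₂]
    · simp [hR, he₁, he₂, hC]
    · simp [hRg, he₁g, hCg, hgk ▸ he₂k]
  rwa [← hs.eq_of_mem _ _ hc.line₃ (le_antisymm (hs.gc.card_le_four hc.line₃) h4) h₃ h₃4 R hR hRl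
    hRg hR₃]

theorem SoleUser.false_of_three_max_of_mem (hs : SoleUser X ℓ A) {M₁ M₂ M₃ : Set Pt}
    (h₁ : IsLine M₁) (h₁4 : (nodesOn X M₁).card = 4) (h₂ : IsLine M₂)
    (h₂4 : (nodesOn X M₂).card = 4) (h₃ : IsLine M₃) (h₃4 : (nodesOn X M₃).card = 4)
    (h₁₂ : M₁ ≠ M₂) (h₁₃ : M₁ ≠ M₃) (h₂₃ : M₂ ≠ M₃) (hA₁ : A ∈ M₁) (hA₂ : A ∈ M₂) : False := by
  classical
  have key : ∀ {x y : Pt} {S : Set Pt}, x ∈ S → y ∉ S → x ≠ y := fun hx hy h => hy (h ▸ hx)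
  have meet : ∀ {L L' : Set Pt} {x y : Pt}, IsLine L → IsLine L' → L ≠ L' → x ∈ L → x ∈ L' →
      x ≠ y → y ∈ L → y ∉ L' :=
    fun hL hL' hne hx hx' hxy hy hy' => hne (hL.eq_of_mem hL' hxy hx hy hx' hy')
  have hA := hs.mem
  have hA₃ := hs.gc.not_concurrent h₁ h₁4 h₂ h₂4 h₃ h₃4 h₁₂ h₁₃ h₂₃ hA hA₁ hA₂
  obtain ⟨P, hP, hP₁, hPl⟩ := hs.exists_mem_of_max h₁ h₁4
  obtain ⟨Q, hQ, hQ₂, hQl⟩ := hs.exists_mem_of_max h₂ h₂4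
  obtain ⟨R, hR, hR₃, hRl⟩ := hs.exists_mem_of_max h₃ h₃4
  obtain ⟨s, hsX, hs₁, hs₃⟩ := hs.gc.exists_mem_of_max h₁ h₁4 h₃ h₃4 h₁₃
  obtain ⟨t, htX, ht₂, ht₃⟩ := hs.gc.exists_mem_of_max h₂ h₂4 h₃ h₃4 h₂₃
  have hAl : A ∉ ℓ := by
    obtain ⟨h, k, hc⟩ := hs.cov
    exact hc.notMem₁
  have hP₂ : P ∉ M₂ := fun h => h₁₂ (hs.eq_of_mem _ _ h₁ h₁4 h₂ h₂4 P hP hPl hP₁ h)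
  have hP₃ : P ∉ M₃ := fun h => h₁₃ (hs.eq_of_mem _ _ h₁ h₁4 h₃ h₃4 P hP hPl hP₁ h)
  have hQ₁ : Q ∉ M₁ := fun h => h₁₂ (hs.eq_of_mem _ _ h₁ h₁4 h₂ h₂4 Q hQ hQl h hQ₂)
  have hQ₃ : Q ∉ M₃ := fun h => h₂₃ (hs.eq_of_mem _ _ h₂ h₂4 h₃ h₃4 Q hQ hQl hQ₂ h)
  have hR₁ : R ∉ M₁ := fun h => h₁₃ (hs.eq_of_mem _ _ h₁ h₁4 h₃ h₃4 R hR hRl h hR₃)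
  have hR₂ : R ∉ M₂ := fun h => h₂₃ (hs.eq_of_mem _ _ h₂ h₂4 h₃ h₃4 R hR hRl h hR₃)
  have hs₂ : s ∉ M₂ := meet h₁ h₂ h₁₂ hA₁ hA₂ (key hs₃ hA₃).symm hs₁
  have ht₁ : t ∉ M₁ := meet h₂ h₁ h₁₂.symm hA₂ hA₁ (key ht₃ hA₃).symm ht₂
  have hPA : P ≠ A := key hPl hAl
  have hQA : Q ≠ A := key hQl hAl
  have hsP : s ≠ P := key hs₃ hP₃
  have htQ : t ≠ Q := key ht₃ hQ₃
  have hsR : s ≠ R := key hs₁ hR₁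
  have htR : t ≠ R := key ht₂ hR₂
  have hst : s ≠ t := key hs₁ ht₁
  have hsA : s ≠ A := key hs₃ hA₃
  have htA : t ≠ A := key ht₃ hA₃
  obtain ⟨e₁, he₁, he₁₁, hAe₁, hPe₁, hse₁, hm₁⟩ :=
    exists_of_card_four h₁4 hA hA₁ hP hP₁ hsX hs₁ hPA.symm hsA.symm hsP.symm
  obtain ⟨e₂, he₂, he₂₂, hAe₂, hQe₂, hte₂, hm₂⟩ :=
    exists_of_card_four h₂4 hA hA₂ hQ hQ₂ htX ht₂ hQA.symm htA.symm htQ.symm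
  obtain ⟨e₃, he₃, he₃₃, hRe₃, hse₃, hte₃, hm₃⟩ :=
    exists_of_card_four h₃4 hR hR₃ hsX hs₃ htX ht₃ hsR.symm htR.symm hst
  have he₁₂ := meet h₁ h₂ h₁₂ hA₁ hA₂ hAe₁ he₁₁
  have he₁₃ := meet h₁ h₃ h₁₃ hs₁ hs₃ hse₁ he₁₁
  have he₁l := meet h₁ hs.line (hs.ne_of_max h₁4).symm hP₁ hPl hPe₁ he₁₁
  have he₂₁ := meet h₂ h₁ h₁₂.symm hA₂ hA₁ hAe₂ he₂₂
  have he₂₃ := meet h₂ h₃ h₂₃ ht₂ ht₃ hte₂ he₂₂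
  have he₂l := meet h₂ hs.line (hs.ne_of_max h₂4).symm hQ₂ hQl hQe₂ he₂₂
  have he₃₁ := meet h₃ h₁ h₁₃.symm hs₃ hs₁ hse₃ he₃₃
  have he₃₂ := meet h₃ h₂ h₂₃.symm ht₃ ht₂ hte₃ he₃₃
  have he₃l := meet h₃ hs.line (hs.ne_of_max h₃4).symm hR₃ hRl hRe₃ he₃₃
  obtain ⟨C, hC, hC₁, hC₂, hC₃⟩ : ∃ C ∈ X, C ∉ M₁ ∧ C ∉ M₂ ∧ C ∉ M₃ := by
    by_contra! hno
    have hsub : X ⊆ [A, P, s, e₁, Q, t, e₂, R, e₃].toFinset := by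
      intro x hx
      simp only [List.mem_toFinset, List.mem_cons, List.not_mem_nil, or_false]
      by_cases hx₁ : x ∈ M₁
      · have := hm₁ x hx hx₁; clear * - this; tauto
      by_cases hx₂ : x ∈ M₂
      · have := hm₂ x hx hx₂; clear * - this; tauto
      · have := hm₃ x hx (hno x hx hx₁ hx₂); clear * - this; tauto
    have h1 := Finset.card_le_card hsub
    have h2 := List.toFinset_card_le [A, P, s, e₁, Q, t, e₂, R, e₃]
    rw [hs.gc.card] at h1
    simp only [List.length_cons, List.length_nil] at h2
    omega
  have hCl : C ∉ ℓ := by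
    intro hCl
    have := four_le_card_nodesOn (X := X) (L := ℓ) (w := P) (x := Q) (y := R) (z := C)
      (by simp [key hP₁ hQ₁, key hP₁ hR₁, key hP₁ hC₁, key hQ₂ hR₂, key hQ₂ hC₂, key hR₃ hC₃])
      (by simp [hP, hQ, hR, hC]) (by simp [hPl, hQl, hRl, hCl])
    have := hs.card
    omega
  obtain ⟨g, k, hc⟩ := hs.cov
  obtain ⟨k, hc⟩ := hc.exists_cov_max h₃ h₃4 hA₃ (hs.ne_of_max h₃4)
  have hk₁ := ((hc.cover e₁ he₁ hAe₁.symm).resolve_left he₁l).resolve_left he₁₃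
  have hk₂ := ((hc.cover e₂ he₂ hAe₂.symm).resolve_left he₂l).resolve_left he₂₃
  have hkC := ((hc.cover C hC (key hA₁ hC₁).symm).resolve_left hCl).resolve_left hC₃
  obtain ⟨h, hh, hPh, heh, hCh⟩ := hs.exists_collinear h₁ h₂ h₂4 h₃ h₃4 hc.line₃ hP hR hsX he₁ he₂
    he₃ hC hPl hRl (key hP₁ hR₁) hP₁ hs₁ he₁₁ hR₃ hs₃ he₃₃ hsP hse₁ hPe₁ hsR hse₃ hRe₃ hP₂ hs₂ he₁₂
    hR₂ he₃₂ he₂₂ he₁₃ hC₁ hC₂ hC₃ hsA hk₁ hk₂ hkC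
  obtain ⟨h', hh', hQh', heh', hCh'⟩ := hs.exists_collinear h₂ h₁ h₁4 h₃ h₃4 hc.line₃ hQ hR htX he₂
    he₁ he₃ hC hQl hRl (key hQ₂ hR₂) hQ₂ ht₂ he₂₂ hR₃ ht₃ he₃₃ htQ hte₂ hQe₂ htR hte₃ hRe₃ hQ₁ ht₁
    he₂₁ hR₁ he₃₁ he₁₁ he₂₃ hC₂ hC₁ hC₃ htA hk₂ hk₁ hkC
  rw [← hh.eq_of_mem hh' (key he₃₃ hC₃) heh hCh heh' hCh'] at hQh'
  rw [hh.eq_of_mem hs.line (key hP₁ hQ₁) hPh hQh' hPl hQl] at hCh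
  exact hCl hCh

theorem SoleUser.false (hs : SoleUser X ℓ A) : False := by
  obtain ⟨M₁, h₁, h₁4⟩ := hs.gc.exists_max
  by_cases only₁ : ∀ L, IsLine L → (nodesOn X L).card = 4 → L = M₁
  · exact hs.false_of_unique_max h₁ h₁4 only₁
  push Not at only₁
  obtain ⟨M₂, h₂, h₂4, h₂₁⟩ := only₁
  by_cases only₂ : ∀ L, IsLine L → (nodesOn X L).card = 4 → L = M₁ ∨ L = M₂
  · exact hs.false_of_two_max h₁ h₁4 h₂ h₂4 h₂₁.symm only₂
  push Not at only₂
  obtain ⟨M₃, h₃, h₃4, h₃₁, h₃₂⟩ := only₂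
  have a₁₂ := hs.mem_or_mem h₁ h₁4 h₂ h₂4 h₂₁.symm
  have a₁₃ := hs.mem_or_mem h₁ h₁4 h₃ h₃4 h₃₁.symm
  have a₂₃ := hs.mem_or_mem h₂ h₂4 h₃ h₃4 h₃₂.symm
  by_cases hA₁ : A ∈ M₁
  · rcases a₂₃ with hA₂ | hA₃
    · exact hs.false_of_three_max_of_mem h₁ h₁4 h₂ h₂4 h₃ h₃4 h₂₁.symm h₃₁.symm h₃₂.symm hA₁ hA₂
    · exact hs.false_of_three_max_of_mem h₁ h₁4 h₃ h₃4 h₂ h₂4 h₃₁.symm h₂₁.symm h₃₂ hA₁ hA₃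
  · exact hs.false_of_three_max_of_mem h₂ h₂4 h₃ h₃4 h₁ h₁4 h₃₂.symm h₂₁ h₃₁
      (a₁₂.resolve_left hA₁) (a₁₃.resolve_left hA₁)

end

theorem IsGCFinset.exists_cov_iff {X : Finset Pt} {ℓ M M' : Set Pt} {A : Pt} (hX : IsGCFinset X)
    (hl : IsLine ℓ) (hl3 : (nodesOn X ℓ).card = 3) (hM : IsLine M) (hM4 : (nodesOn X M).card = 4)
    (hM' : IsLine M') (hM4' : (nodesOn X M').card = 4) (hne : M ≠ M') (hA : A ∈ X) (hAl : A ∈ ℓ)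
    (hAM : A ∈ M) (hAM' : A ∈ M') {B : Pt} (hB : B ∈ X) :
    (∃ h k, Cov X B ℓ h k) ↔ B ∉ ℓ ∧ B ∉ M ∧ B ∉ M' := by
  have hlM : ℓ ≠ M := by rintro rfl; omega
  have hlM' : ℓ ≠ M' := by rintro rfl; omega
  have key : ∀ {M M'}, IsLine M → (nodesOn X M).card = 4 → IsLine M' → (nodesOn X M').card = 4 →
      M ≠ M' → ℓ ≠ M → ℓ ≠ M' → A ∈ M → A ∈ M' → (∃ h k, Cov X B ℓ h k) → B ∉ M := by
    rintro M M' hM hM4 hM' hM4' hne hlM hlM' hAM hAM' ⟨h, k, hc⟩ hBM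
    have hAB : A ≠ B := by rintro rfl; exact hc.notMem₁ hAl
    have hoff : ∀ {N}, IsLine N → N ≠ M → A ∈ N → ∀ x, A ≠ x → x ∈ M → x ∉ N :=
      fun hN hNM hAN x hx hxM hxN => hNM (hN.eq_of_mem hM hx hAN hxN hAM hxM)
    obtain ⟨k, hc⟩ := hc.exists_cov_max hM' hM4' (hoff hM' hne.symm hAM' B hAB hBM) hlM'
    obtain ⟨x, y, hx, hy, hxM, hyM, hAx, hAy, hBx, hBy, hxy, -⟩ :=
      exists_pair_of_card_four hM4 hA hAM hB hBM hAB
    have hk : ∀ z ∈ X, z ∈ M → A ≠ z → B ≠ z → z ∈ k := fun z hz hzM hAz hBz =>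
      ((hc.cover z hz hBz.symm).resolve_left (hoff hl hlM hAl z hAz hzM)).resolve_left
        (hoff hM' hne.symm hAM' z hAz hzM)
    apply hc.notMem₃
    rwa [hc.line₃.eq_of_mem hM hxy (hk x hx hxM hAx hBx) (hk y hy hyM hAy hBy) hxM hyM]
  constructor
  · intro h
    refine ⟨?_, key hM hM4 hM' hM4' hne hlM hlM' hAM hAM' h,
      key hM' hM4' hM hM4 hne.symm hlM' hlM hAM' hAM h⟩
    obtain ⟨h, k, hc⟩ := h
    exact hc.notMem₁
  · rintro ⟨hBl, hBM, hBM'⟩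
    obtain ⟨_, _, hc⟩ := hX.exists_cov_max hB hM hM4 hBM
    obtain ⟨k, hc⟩ := hc.exists_cov_max hM' hM4' hBM' hne
    obtain ⟨x, y, hx, hy, hxl, hyl, hAx, hAy, hxy, -⟩ := exists_pair_of_card_three hl3 hA hAl
    have hk : ∀ z ∈ X, z ∈ ℓ → A ≠ z → z ∈ k := fun z hz hzl hAz =>
      ((hc.cover z hz (by rintro rfl; exact hBl hzl)).resolve_left
        fun h => hlM (hl.eq_of_mem hM hAz hAl hzl hAM h)).resolve_left
        fun h => hlM' (hl.eq_of_mem hM' hAz hAl hzl hAM' h)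
    rw [hl.eq_of_mem hc.line₃ hxy hxl hyl (hk x hx hxl hAx) (hk y hy hyl hAy)]
    exact ⟨_, _, hc.swap₂₃.swap₁₂⟩

theorem IsGCFinset.card_sdiff_eq_one {X : Finset Pt} {ℓ M M' : Set Pt} {A : Pt}
    (hX : IsGCFinset X) (hl : IsLine ℓ) (hl3 : (nodesOn X ℓ).card = 3) (hM : IsLine M)
    (hM4 : (nodesOn X M).card = 4) (hM' : IsLine M') (hM4' : (nodesOn X M').card = 4)
    (hne : M ≠ M') (hA : A ∈ X) (hAl : A ∈ ℓ) (hAM : A ∈ M) (hAM' : A ∈ M') :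
    ((X : Set Pt) \ (ℓ ∪ M ∪ M')).ncard = 1 := by
  classical
  have hlM : ℓ ≠ M := by rintro rfl; omega
  have hlM' : ℓ ≠ M' := by rintro rfl; omega
  have he : ∀ {N : Set Pt}, A ∈ N → ((nodesOn X N).erase A).card = (nodesOn X N).card - 1 :=
    fun hN => Finset.card_erase_of_mem (by simp [hA, hN])
  have hd : ∀ {N N' : Set Pt}, IsLine N → IsLine N' → N ≠ N' → A ∈ N → A ∈ N' →
      Disjoint ((nodesOn X N).erase A) ((nodesOn X N').erase A) := by
    intro N N' hN hN' hne hAN hAN'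
    rw [Finset.disjoint_left]
    intro x hx hx'
    simp only [Finset.mem_erase, mem_nodesOn] at hx hx'
    exact hne (hN.eq_of_mem hN' hx.1 hx.2.2 hAN hx'.2.2 hAN')
  have hU : ((nodesOn X ℓ).erase A ∪ ((nodesOn X M).erase A ∪ (nodesOn X M').erase A)).card = 8 := by
    rw [Finset.card_union_of_disjoint (Finset.disjoint_union_right.mpr
        ⟨hd hl hM hlM hAl hAM, hd hl hM' hlM' hAl hAM'⟩),
      Finset.card_union_of_disjoint (hd hM hM' hne hAM hAM'), he hAl, he hAM, he hAM', hl3, hM4,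
      hM4']
  have heq : (X : Set Pt) \ (ℓ ∪ M ∪ M') = ↑(X.erase A \
      ((nodesOn X ℓ).erase A ∪ ((nodesOn X M).erase A ∪ (nodesOn X M').erase A))) := by
    ext x
    simp only [Set.mem_sdiff, Finset.mem_coe, Set.mem_union, Finset.mem_sdiff, Finset.mem_erase,
      Finset.mem_union, mem_nodesOn]
    by_cases hx : x = A
    · subst hx; tauto
    · tauto
  rw [heq, Set.ncard_coe_finset, Finset.card_sdiff_of_subset, hU, Finset.card_erase_of_mem hA,
    hX.card]
  intro x hx
  simp only [Finset.mem_union, Finset.mem_erase, mem_nodesOn] at hx ⊢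
  tauto

/-- A line used by exactly one node passes through the intersection node of two maximal lines. -/
theorem IsGCFinset.exists_max_pair {X : Finset Pt} {ℓ : Set Pt} {A : Pt} (hX : IsGCFinset X)
    (hl : IsLine ℓ) (hl3 : (nodesOn X ℓ).card = 3) (hA : A ∈ X) (hc : ∃ h k, Cov X A ℓ h k)
    (huse : ∀ B ∈ X, ∀ h k, Cov X B ℓ h k → B = A) :
    ∃ M M', (IsLine M ∧ (nodesOn X M).card = 4) ∧ (IsLine M' ∧ (nodesOn X M').card = 4) ∧
      M ≠ M' ∧ ∃ x ∈ X, x ∈ ℓ ∧ x ∈ M ∧ x ∈ M' := by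
  by_contra! hno
  refine SoleUser.false (X := X) (ℓ := ℓ) (A := A) ⟨hX, hl, hl3, hA, hc, huse, ?_⟩
  intro M M' hM hM4 hM' hM4' x hx hxl hxM hxM'
  by_contra hne
  exact hno M M' ⟨hM, hM4⟩ ⟨hM', hM4'⟩ hne x hx hxl hxM hxM'

/-- For a `GC_3` set `X` and a `3`-node line `ℓ`: `|X_ℓ| = 1` iff there are two
maximal lines `M'`, `M''` whose intersection point is a node of `X` on `ℓ`; in this case
`X_ℓ = X \ (ℓ ∪ M' ∪ M'')`. -/
theorem GC3_useSet_card_eq_one_iff (X ℓ : Set Pt) (hX : IsGC 3 X)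
    (hℓ : IsNodeLine 3 X ℓ) :
    ((UseSet 3 X ℓ).ncard = 1 ↔
      ∃ M' M'' : Set Pt, IsMaxLine 3 X M' ∧ IsMaxLine 3 X M'' ∧ M' ≠ M'' ∧
        ∃ A : Pt, A ∈ X ∧ A ∈ ℓ ∧ A ∈ M' ∧ A ∈ M'') ∧
    ((UseSet 3 X ℓ).ncard = 1 →
      ∃ M' M'' : Set Pt, IsMaxLine 3 X M' ∧ IsMaxLine 3 X M'' ∧ M' ≠ M'' ∧
        (∃ A : Pt, A ∈ X ∧ A ∈ ℓ ∧ A ∈ M' ∧ A ∈ M'') ∧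
        UseSet 3 X ℓ = X \ (ℓ ∪ M' ∪ M'')) := by
  have hfin : X.Finite := Set.finite_of_ncard_ne_zero (by rw [hX.1.1]; norm_num)
  lift X to Finset Pt using hfin
  have hG := hX.isGCFinset
  obtain ⟨hl, hl3⟩ := isNodeLine_iff.1 hℓ
  have hne : ℓ.Nonempty := by
    obtain ⟨A, hA⟩ := Finset.card_pos.1 (hl3 ▸ three_pos)
    exact ⟨A, (mem_nodesOn.1 hA).2⟩
  have huse : ∀ {B}, B ∈ UseSet 3 X ℓ ↔ B ∈ X ∧ ∃ h k, Cov X B ℓ h k := fun {B} =>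
    ⟨fun h => ⟨h.1, exists_cov_of_uses hX h.1 hne h.2⟩, fun ⟨hB, h, k, hc⟩ => ⟨hB, uses_of_cov hc⟩⟩
  have heq : ∀ M' M'' : Set Pt, IsMaxLine 3 X M' → IsMaxLine 3 X M'' → M' ≠ M'' →
      (∃ A ∈ (X : Set Pt), A ∈ ℓ ∧ A ∈ M' ∧ A ∈ M'') →
      UseSet 3 X ℓ = (X : Set Pt) \ (ℓ ∪ M' ∪ M'') ∧ (UseSet 3 X ℓ).ncard = 1 := by
    rintro M' M'' hM hM' hMM ⟨A, hA, hAl, hAM, hAM'⟩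
    obtain ⟨hM, hM4⟩ := isNodeLine_iff.1 hM
    obtain ⟨hM', hM4'⟩ := isNodeLine_iff.1 hM'
    have h : UseSet 3 X ℓ = (X : Set Pt) \ (ℓ ∪ M' ∪ M'') := by
      ext B
      rw [huse, Set.mem_sdiff, Set.mem_union, Set.mem_union, not_or, not_or, and_assoc]
      exact and_congr_right fun hB =>
        hG.exists_cov_iff hl hl3 hM hM4 hM' hM4' hMM hA hAl hAM hAM' hB
    exact ⟨h, h ▸ hG.card_sdiff_eq_one hl hl3 hM hM4 hM' hM4' hMM hA hAl hAM hAM'⟩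
  have hex : (UseSet 3 X ℓ).ncard = 1 → ∃ M' M'' : Set Pt, IsMaxLine 3 X M' ∧ IsMaxLine 3 X M'' ∧
      M' ≠ M'' ∧ ∃ A ∈ (X : Set Pt), A ∈ ℓ ∧ A ∈ M' ∧ A ∈ M'' := by
    intro h
    obtain ⟨A, hA⟩ := Set.ncard_eq_one.1 h
    obtain ⟨hAX, hc⟩ := huse.1 (hA ▸ Set.mem_singleton A)
    obtain ⟨M', M'', hM, hM', hMM, hx⟩ := hG.exists_max_pair hl hl3 hAX hc fun B hB h k hB' => by
      have : B ∈ UseSet 3 X ℓ := huse.2 ⟨hB, h, k, hB'⟩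
      rwa [hA] at this
    exact ⟨M', M'', isNodeLine_iff.2 hM, isNodeLine_iff.2 hM', hMM, hx⟩
  refine ⟨⟨hex, fun ⟨M', M'', hM, hM', hMM, hx⟩ => (heq M' M'' hM hM' hMM hx).2⟩, fun h => ?_⟩
  obtain ⟨M', M'', hM, hM', hMM, hx⟩ := hex h
  exact ⟨M', M'', hM, hM', hMM, hx, (heq M' M'' hM hM' hMM hx).1⟩
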